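/- Let (Q,R) be a connected acyclic bound quiver with bound quiver algebra A = ℂQ/⟨R⟩, let β ∈ ℕ^{Q_0} be a dimension vector, and let W ∈ mod(A,β) be an A-module such that B := A/Ann_A(W) is a tame algebra. Then every weight σ ∈ L_W is W-saturated, i.e., if nσ ∈ S_Q(W) for some integer n ≥ 1 for a weight σ ∈ L_W, then σ ∈ S_Q(W). -/

import Mathlib

open Matrix
noncomputable section

/-- A (finite-vertex) quiver: vertices, arrows, tail and head maps. -/
structure Quiv where
  V : Type
  A : Type
  t : A → V
  h : A → V
  [fV : Fintype V]
  [dV : DecidableEq V]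

attribute [instance] Quiv.fV Quiv.dV

/-- The `Quiver` structure on the vertices of `Q`: an arrow from `x` to `y` is an
arrow of `Q` with tail `x` and head `y`.  This gives us `Quiver.Path x y`, the type of
oriented paths from `x` to `y` in `Q`. -/
instance quivToQuiver (Q : Quiv) : Quiver Q.V := ⟨fun x y => {a : Q.A // Q.t a = x ∧ Q.h a = y}⟩

/-- The space of matrix representations of `Q` of dimension vector `β`, with entries in a
commutative ring `R`. -/
def RepR (Q : Quiv) (R : Type) (β : Q.V → ℕ) := ∀ a : Q.A, Matrix (Fin (β (Q.h a))) (Fin (β (Q.t a))) R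

/-- The representation space `rep(Q,β) = ∏_{a ∈ Q₁} ℂ^{β(ha) × β(ta)}`. -/
abbrev QRep (Q : Quiv) (β : Q.V → ℕ) := RepR Q ℂ β

/-- Transport of a rectangular matrix along equalities of its sizes. -/
def castM {R : Type} {m n m' n' : ℕ} (hm : m = m') (hn : n = n')
    (M : Matrix (Fin m) (Fin n) R) : Matrix (Fin m') (Fin n') R :=
  M.submatrix (Fin.cast hm.symm) (Fin.cast hn.symm)

/-- The value `W(p)` of a representation `W` on an oriented path `p` (the product of the
matrices attached to the arrows of `p`; the trivial path gives the identity matrix). -/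
def evalPath {Q : Quiv} {R : Type} [CommRing R] {β : Q.V → ℕ} (W : RepR Q R β) :
    ∀ {x y : Q.V}, Quiver.Path x y → Matrix (Fin (β y)) (Fin (β x)) R
  | _, _, Quiver.Path.nil => 1
  | _, _, Quiver.Path.cons p e =>
      (castM (congrArg β e.2.2) (congrArg β e.2.1) (W e.1)) * evalPath W p
variable (Q : Quiv)

/-- A formal (finite) linear combination of parallel oriented paths in `Q`, together with its
endpoints: the element of the path algebra it represents lives in `e_y · ℂQ · e_x`. -/
def FormalRel := Σ (x : Q.V) (y : Q.V), (Quiver.Path x y →₀ ℂ)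

variable {Q}

/-- Evaluation of a representation on a formal linear combination of parallel paths. -/
def evalLin {β : Q.V → ℕ} (W : QRep Q β) {x y : Q.V} (c : Quiver.Path x y →₀ ℂ) :
    Matrix (Fin (β y)) (Fin (β x)) ℂ :=
  c.sum fun p k => k • evalPath W p

/-- Evaluation of a representation over `ℂ[x]` on a formal linear combination of paths. -/
def evalLinP {β : Q.V → ℕ} (W : RepR Q (Polynomial ℂ) β) {x y : Q.V}
    (c : Quiver.Path x y →₀ ℂ) : Matrix (Fin (β y)) (Fin (β x)) (Polynomial ℂ) :=
  c.sum fun p k => (Polynomial.C k) • evalPath W p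

/-- The module variety `mod(A,β)` of the algebra `A = ℂQ/⟨S⟩`: all `β`-dimensional
representations of `Q` annihilating every relation in `S`. -/
def modSet (S : Set (FormalRel Q)) (β : Q.V → ℕ) : Set (QRep Q β) :=
  {W | ∀ r ∈ S, evalLin W r.2.2 = 0}

/-- A set of relations is admissible if every path occurring in it has length at least two. -/
def AdmissibleRels (S : Set (FormalRel Q)) : Prop :=
  ∀ r ∈ S, ∀ p ∈ r.2.2.support, 2 ≤ p.length

/-- The base change group `GL(β) = ∏_x GL(β(x),ℂ)`. -/
abbrev GLb (β : Q.V → ℕ) := ∀ x : Q.V, Matrix.GeneralLinearGroup (Fin (β x)) ℂ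

/-- The action of `GL(β)` on `rep(Q,β)` by simultaneous conjugation. -/
def gAct {β : Q.V → ℕ} (g : GLb β) (W : QRep Q β) : QRep Q β :=
  fun a => ((g (Q.h a)).val) * W a * (((g (Q.t a))⁻¹).val)

/-- The character of `GL(β)` induced by the weight `σ`: `g ↦ ∏_x det(g(x))^{σ(x)}`.  -/
def chi {β : Q.V → ℕ} (σ : Q.V → ℤ) (g : GLb β) : ℂ :=
  ∏ x : Q.V, ((g x).val.det) ^ (σ x)

/-- Index type of the coordinates on `rep(Q,β)`. -/
def RepCoord (β : Q.V → ℕ) := Σ a : Q.A, Fin (β (Q.h a)) × Fin (β (Q.t a))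

/-- The coordinates of a point of `rep(Q,β)`. -/
def repCoords {β : Q.V → ℕ} (W : QRep Q β) : RepCoord (Q := Q) β → ℂ :=
  fun c => W c.1 c.2.1 c.2.2

/-- `F` is a polynomial function on `rep(Q,β)`. -/
def IsPolyFun {β : Q.V → ℕ} (F : QRep Q β → ℂ) : Prop :=
  ∃ P : MvPolynomial (RepCoord (Q := Q) β) ℂ, ∀ W, F W = MvPolynomial.eval (repCoords W) P

/-- `F` is a semi-invariant of weight `σ` on `rep(Q,β)`. -/
def IsSemiInvariant {β : Q.V → ℕ} (σ : Q.V → ℤ) (F : QRep Q β → ℂ) : Prop :=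
  IsPolyFun F ∧ ∀ (g : GLb β) (W : QRep Q β), F (gAct g W) = chi σ g * F W

/-- The orbit semigroup `S_Q(W)` of a representation `W ∈ rep(Q,β)`: all weights `σ` admitting
a semi-invariant of weight `σ` not vanishing at `W`. -/
def OrbitSemigroup {β : Q.V → ℕ} (W : QRep Q β) : Set (Q.V → ℤ) :=
  {σ | ∃ F : QRep Q β → ℂ, IsSemiInvariant σ F ∧ F W ≠ 0}

/-- `W` is `σ`-semi-stable: some positive multiple of `σ` lies in the orbit semigroup. -/
def SemiStable {β : Q.V → ℕ} (σ : Q.V → ℤ) (W : QRep Q β) : Prop :=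
  ∃ n : ℕ, 1 ≤ n ∧ (fun x => (n : ℤ) * σ x) ∈ OrbitSemigroup W

/-- The weight `σ` is `W`-saturated: if `nσ` lies in the orbit semigroup of `W` for some
integer `n ≥ 1`, then so does `σ`. -/
def WSaturated {β : Q.V → ℕ} (W : QRep Q β) (σ : Q.V → ℤ) : Prop :=
  (∃ n : ℕ, 1 ≤ n ∧ (fun x => (n : ℤ) * σ x) ∈ OrbitSemigroup W) → σ ∈ OrbitSemigroup W

/-- `Q` is connected: any two vertices are joined by an unoriented walk. -/
def QConnected (Q : Quiv) : Prop :=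
  ∀ x y : Q.V, Relation.ReflTransGen
    (fun u v => ∃ a : Q.A, (Q.t a = u ∧ Q.h a = v) ∨ (Q.t a = v ∧ Q.h a = u)) x y

/-- `Q` is acyclic: the only oriented path from a vertex to itself is the trivial one. -/
def QAcyclic (Q : Quiv) : Prop := ∀ (x : Q.V) (p : Quiver.Path x x), p = Quiver.Path.nil
section Capacity

variable (Q : Quiv) (β : Q.V → ℕ) (σ : Q.V → ℤ)

/-- Vertices where the weight `σ` is positive. -/
abbrev PosV := {x : Q.V // 0 < σ x}

/-- Vertices where the weight `σ` is negative. -/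
abbrev NegV := {x : Q.V // σ x < 0}

/-- `σ₊` at a positive vertex. -/
abbrev posP (i : PosV Q σ) : ℕ := (σ i.1).toNat

/-- `σ₋` at a negative vertex. -/
abbrev negP (j : NegV Q σ) : ℕ := (-σ j.1).toNat

/-- Row index type of the `N × N` block matrices: block rows are indexed by pairs `(j,q)`
with `q ∈ I_j⁻`, each of height `β(w_j)`; so `N = Σ_j σ₋(w_j)β(w_j)` rows in total. -/
abbrev RowT := Σ j : NegV Q σ, Fin (negP Q σ j) × Fin (β j.1)

/-- Column index type of the `N × N` block matrices: block columns indexed by pairs `(i,r)`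
with `r ∈ I_i⁺`, each of width `β(v_i)`; so `N = Σ_i σ₊(v_i)β(v_i)` columns in total. -/
abbrev ColT := Σ i : PosV Q σ, Fin (posP Q σ i) × Fin (β i.1)

/-- The index set `I_σ = {(i,j,p,q,r)}`. -/
structure BIdx where
  i : PosV Q σ
  j : NegV Q σ
  p : Quiver.Path i.1 j.1
  q : Fin (negP Q σ j)
  r : Fin (posP Q σ i)

variable {Q β σ}

/-- The block matrix `W^{i,j,p}_{q,r}`: its `(q,r)` block entry is `W(p)` and all other
entries vanish. -/
def blockMat (W : QRep Q β) (d : BIdx Q σ) : Matrix (RowT Q β σ) (ColT Q β σ) ℂ :=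
  fun s u =>
    if hj : s.1 = d.j then
      if hi : u.1 = d.i then
        if Fin.cast (congrArg (negP Q σ) hj) s.2.1 = d.q ∧
           Fin.cast (congrArg (posP Q σ) hi) u.2.1 = d.r then
          evalPath W d.p (Fin.cast (congrArg (fun z => β z.1) hj) s.2.2)
            (Fin.cast (congrArg (fun z => β z.1) hi) u.2.2)
        else 0
      else 0
    else 0

/-- The Brascamp–Lieb (completely positive) operator `T_{W,σ}` associated to the quiver
datum `(W,σ)`, with Kraus operators the block matrices `W^{i,j,p}_{q,r}`. -/
def BLop (W : QRep Q β) (X : Matrix (RowT Q β σ) (RowT Q β σ) ℂ) :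
    Matrix (ColT Q β σ) (ColT Q β σ) ℂ :=
  ∑ᶠ d : BIdx Q σ, (blockMat W d)ᵀ * X * blockMat W d

/-- The capacity `cap_Q(W,σ)` of the quiver datum `(W,σ)`: the infimum of
`Det (T_{W,σ}(X))` over real positive definite matrices `X` with `Det X = 1`. -/
def capQ (W : QRep Q β) : ℝ :=
  sInf {r : ℝ | ∃ X : Matrix (RowT Q β σ) (RowT Q β σ) ℝ, X.PosDef ∧ X.det = 1 ∧
    r = ((BLop (σ := σ) W (X.map Complex.ofReal)).det).re}

/-- `Span_ℂ(W^{i,j,p}_{q,r} : (i,j,p,q,r) ∈ I_σ)` contains a non-singular `N × N` matrix. -/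
def SpanNonsingular (W : QRep Q β) (σ : Q.V → ℤ) : Prop :=
  ∃ M ∈ Submodule.span ℂ (Set.range (blockMat (σ := σ) W)),
    Function.Bijective (Matrix.mulVecLin M)

end Capacity
section HomExt

variable {Q : Quiv}

/-- The space of morphisms of representations `Hom(V,W)`, as a subspace of
`∏_x Hom(V(x),W(x))` (in matrix form). -/
def HomS {α γ : Q.V → ℕ} (V : QRep Q α) (W : QRep Q γ) :
    Submodule ℂ (∀ x : Q.V, Matrix (Fin (γ x)) (Fin (α x)) ℂ) where
  carrier := {φ | ∀ a : Q.A, φ (Q.h a) * V a = W a * φ (Q.t a)}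
  add_mem' := by
    intro φ ψ hφ hψ a
    simp only [Pi.add_apply, Matrix.add_mul, Matrix.mul_add, hφ a, hψ a]
  zero_mem' := by intro a; simp
  smul_mem' := by
    intro c φ hφ a
    simp only [Pi.smul_apply, Matrix.smul_mul, Matrix.mul_smul, hφ a]

/-- `dim_ℂ Hom(V,W)`. -/
def dimHom {α γ : Q.V → ℕ} (V : QRep Q α) (W : QRep Q γ) : ℕ :=
  Module.finrank ℂ (HomS V W)

/-- A family of matrices is componentwise surjective (as linear maps). -/
def MorSurj {α γ : Q.V → ℕ} (φ : ∀ x : Q.V, Matrix (Fin (γ x)) (Fin (α x)) ℂ) : Prop :=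
  ∀ x, Function.Surjective (Matrix.mulVecLin (φ x))

/-- A family of matrices is componentwise injective (as linear maps). -/
def MorInj {α γ : Q.V → ℕ} (φ : ∀ x : Q.V, Matrix (Fin (γ x)) (Fin (α x)) ℂ) : Prop :=
  ∀ x, Function.Injective (Matrix.mulVecLin (φ x))

/-- Isomorphism of representations (possibly of different dimension vectors). -/
def RIso {α γ : Q.V → ℕ} (V : QRep Q α) (W : QRep Q γ) : Prop :=
  ∃ u : ∀ x : Q.V, ((Fin (α x) → ℂ) ≃ₗ[ℂ] (Fin (γ x) → ℂ)),
    ∀ a : Q.A, (u (Q.h a)).toLinearMap ∘ₗ (V a).mulVecLin =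
      (W a).mulVecLin ∘ₗ (u (Q.t a)).toLinearMap

/-- The space of `1`-cochains from `V` to `W`: families `φ(a) : V(ta) → W(ha)`. -/
abbrev C1sp (α γ : Q.V → ℕ) := ∀ a : Q.A, Matrix (Fin (γ (Q.h a))) (Fin (α (Q.t a))) ℂ

/-- The derivative (Leibniz rule) of a path with respect to a `1`-cochain `φ`:
`D_{a_s ⋯ a_1}(φ) = Σ_k W(a_s ⋯ a_{k+1}) φ(a_k) V(a_{k-1} ⋯ a_1)`. -/
def der {α γ : Q.V → ℕ} (V : QRep Q α) (W : QRep Q γ) (φ : C1sp (Q := Q) α γ) :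
    ∀ {x y : Q.V}, Quiver.Path x y → Matrix (Fin (γ y)) (Fin (α x)) ℂ
  | _, _, Quiver.Path.nil => 0
  | _, _, Quiver.Path.cons p e =>
      castM (congrArg γ e.2.2) (congrArg α e.2.1) (φ e.1) * evalPath V p
      + castM (congrArg γ e.2.2) (congrArg γ e.2.1) (W e.1) * der V W φ p

lemma der_add {α γ : Q.V → ℕ} (V : QRep Q α) (W : QRep Q γ) (φ ψ : C1sp (Q := Q) α γ)
    {x y : Q.V} (p : Quiver.Path x y) :
    der V W (φ + ψ) p = der V W φ p + der V W ψ p := by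
  induction p with
  | nil => simp [der]
  | cons p e ih =>
      simp only [der, ih, Pi.add_apply, castM, Matrix.submatrix_add, Matrix.add_mul,
        Matrix.mul_add]
      abel

lemma der_smul {α γ : Q.V → ℕ} (V : QRep Q α) (W : QRep Q γ) (c : ℂ) (φ : C1sp (Q := Q) α γ)
    {x y : Q.V} (p : Quiver.Path x y) :
    der V W (c • φ) p = c • der V W φ p := by
  induction p with
  | nil => simp [der]
  | cons p e ih =>
      simp only [der, ih, Pi.smul_apply, castM, Matrix.submatrix_smul, Matrix.smul_mul,
        Matrix.mul_smul, smul_add]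

lemma der_zero {α γ : Q.V → ℕ} (V : QRep Q α) (W : QRep Q γ)
    {x y : Q.V} (p : Quiver.Path x y) :
    der V W (0 : C1sp (Q := Q) α γ) p = 0 := by
  induction p with
  | nil => simp [der]
  | cons p e ih =>
      simp [der, ih, castM]

/-- The derivative of a formal linear combination of parallel paths. -/
def derRel {α γ : Q.V → ℕ} (V : QRep Q α) (W : QRep Q γ) (φ : C1sp (Q := Q) α γ)
    {x y : Q.V} (c : Quiver.Path x y →₀ ℂ) : Matrix (Fin (γ y)) (Fin (α x)) ℂ :=
  c.sum fun p k => k • der V W φ p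

/-- The space of `1`-cocycles relative to the set of relations `S`: cochains whose
derivative kills every relation in `S`. -/
def Z1 (S : Set (FormalRel Q)) {α γ : Q.V → ℕ} (V : QRep Q α) (W : QRep Q γ) :
    Submodule ℂ (C1sp (Q := Q) α γ) where
  carrier := {φ | ∀ r ∈ S, derRel V W φ r.2.2 = 0}
  add_mem' := by
    intro φ ψ hφ hψ r hr
    have : derRel V W (φ + ψ) r.2.2 = derRel V W φ r.2.2 + derRel V W ψ r.2.2 := by
      simp only [derRel, der_add, smul_add]
      exact Finsupp.sum_add
    rw [this, hφ r hr, hψ r hr, add_zero]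
  zero_mem' := by
    intro r hr
    simp [derRel, der_zero]
  smul_mem' := by
    intro c φ hφ r hr
    have : derRel V W (c • φ) r.2.2 = c • derRel V W φ r.2.2 := by
      simp only [derRel, der_smul, Finsupp.smul_sum, smul_comm c]
    rw [this, hφ r hr, smul_zero]

/-- The coboundary map `d⁰ : ∏_x Hom(V(x),W(x)) → C¹`,
`f ↦ (a ↦ f(ha) V(a) − W(a) f(ta))`. -/
def d0map {α γ : Q.V → ℕ} (V : QRep Q α) (W : QRep Q γ) :
    (∀ x : Q.V, Matrix (Fin (γ x)) (Fin (α x)) ℂ) →ₗ[ℂ] C1sp (Q := Q) α γ where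
  toFun f := fun a => f (Q.h a) * V a - W a * f (Q.t a)
  map_add' f g := by
    funext a
    simp only [Pi.add_apply, Matrix.add_mul, Matrix.mul_add]
    abel
  map_smul' c f := by
    funext a
    simp only [Pi.smul_apply, Matrix.smul_mul, Matrix.mul_smul, smul_sub, RingHom.id_apply]

/-- The space of `1`-coboundaries. -/
def B1 {α γ : Q.V → ℕ} (V : QRep Q α) (W : QRep Q γ) : Submodule ℂ (C1sp (Q := Q) α γ) :=
  LinearMap.range (d0map V W)

/-- `dim_ℂ Ext¹(V,W)` over the algebra `ℂQ/⟨S⟩`, computed as the dimension of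
`Z¹/B¹` (for modules, `B¹ ⊆ Z¹`, so this is `dim Z¹ − dim B¹`). -/
def dimExt1 (S : Set (FormalRel Q)) {α γ : Q.V → ℕ} (V : QRep Q α) (W : QRep Q γ) : ℕ :=
  Module.finrank ℂ (Z1 S V W) - Module.finrank ℂ ↥((B1 V W) ⊓ (Z1 S V W))

end HomExt
section ProjPdim

variable {Q : Quiv}

/-- `P` is a projective module over `ℂQ/⟨S⟩` (in matrix-representation form):
every morphism from `P` to the target of a surjection of modules lifts. -/
def IsProjRep (S : Set (FormalRel Q)) {γ : Q.V → ℕ} (P : QRep Q γ) : Prop :=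
  ∀ (δ ε : Q.V → ℕ) (M : QRep Q δ) (N : QRep Q ε), M ∈ modSet S δ → N ∈ modSet S ε →
    ∀ g ∈ HomS M N, MorSurj g → ∀ f ∈ HomS P N,
      ∃ h ∈ HomS P M, ∀ x, g x * h x = f x

/-- `V` has projective dimension at most one over `ℂQ/⟨S⟩`: there is a short exact
sequence `0 → P₁ → P₀ → V → 0` with `P₀, P₁` projective. -/
def PdimLE1 (S : Set (FormalRel Q)) {β : Q.V → ℕ} (V : QRep Q β) : Prop :=
  ∃ (γ₀ γ₁ : Q.V → ℕ) (P₀ : QRep Q γ₀) (P₁ : QRep Q γ₁),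
    P₀ ∈ modSet S γ₀ ∧ P₁ ∈ modSet S γ₁ ∧ IsProjRep S P₀ ∧ IsProjRep S P₁ ∧
    ∃ i ∈ HomS P₁ P₀, ∃ p ∈ HomS P₀ V, MorInj i ∧ MorSurj p ∧
      ∀ x, LinearMap.range (Matrix.mulVecLin (i x)) = LinearMap.ker (Matrix.mulVecLin (p x))

/-- The set `P_A(α) = {V ∈ mod(A,α) : pdim_A V ≤ 1}` where `A = ℂQ/⟨S⟩`. -/
def PAset (S : Set (FormalRel Q)) (α : Q.V → ℕ) : Set (QRep Q α) :=
  {V | V ∈ modSet S α ∧ PdimLE1 S V}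

end ProjPdim

section Zariski

/-- The Zariski topology on the affine space `ι → ℂ`: generated by the complements of
hypersurfaces. -/
def zarPi (ι : Type) : TopologicalSpace (ι → ℂ) :=
  TopologicalSpace.generateFrom
    {U | ∃ p : MvPolynomial ι ℂ, U = {w | MvPolynomial.eval w p ≠ 0}}

variable {Q : Quiv}

/-- The Zariski topology on `rep(Q,β)`. -/
def zarTop (β : Q.V → ℕ) : TopologicalSpace (QRep Q β) :=
  TopologicalSpace.induced (repCoords (β := β)) (zarPi _)

/-- Zariski closure in `rep(Q,β)`. -/
def zclosure {β : Q.V → ℕ} (s : Set (QRep Q β)) : Set (QRep Q β) :=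
  @closure _ (zarTop β) s

/-- Zariski-open. -/
def zIsOpen {β : Q.V → ℕ} (s : Set (QRep Q β)) : Prop := @IsOpen _ (zarTop β) s

/-- Zariski-closed. -/
def zIsClosed {β : Q.V → ℕ} (s : Set (QRep Q β)) : Prop := @IsClosed _ (zarTop β) s

/-- Irreducibility in the Zariski topology. -/
def zIrred {β : Q.V → ℕ} (s : Set (QRep Q β)) : Prop := @IsIrreducible _ (zarTop β) s

/-- Dimension of a subset of `rep(Q,β)`: the topological Krull dimension in the
(subspace) Zariski topology. -/
def zdim {β : Q.V → ℕ} (s : Set (QRep Q β)) : WithBot ℕ∞ :=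
  @topologicalKrullDim s (TopologicalSpace.induced Subtype.val (zarTop β))

/-- `C(α)`: the closure of `P_A(α)`. -/
def Cset (S : Set (FormalRel Q)) (α : Q.V → ℕ) : Set (QRep Q α) := zclosure (PAset S α)

/-- `C` is an irreducible component of `M` (for `M` closed in `rep(Q,α)`): a maximal
irreducible closed subset of `M`. -/
def IsIrrCompOf {β : Q.V → ℕ} (C M : Set (QRep Q β)) : Prop :=
  zIrred C ∧ zIsClosed C ∧ C ⊆ M ∧
    ∀ C' : Set (QRep Q β), zIrred C' → zIsClosed C' → C' ⊆ M → C ⊆ C' → C' = C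

/-- `V` is an indecomposable representation: it is nonzero and its endomorphism algebra
has no idempotents other than `0` and `1`. -/
def IsIndecRep {α : Q.V → ℕ} (V : QRep Q α) : Prop :=
  (∃ x, α x ≠ 0) ∧
  ∀ φ ∈ HomS V V, (∀ x, φ x * φ x = φ x) → φ = 0 ∨ φ = fun x => (1 : Matrix _ _ ℂ)

/-- `C` is an indecomposable irreducible component of `M`: an irreducible component
containing a dense open subset of indecomposable representations. -/
def IsIndecComp {β : Q.V → ℕ} (C M : Set (QRep Q β)) : Prop :=
  IsIrrCompOf C M ∧
  ∃ U : Set (QRep Q β), zIsOpen U ∧ C ⊆ zclosure (C ∩ U) ∧ ∀ V ∈ C ∩ U, IsIndecRep V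

/-- The `GL(α)`-orbit of `V`. -/
def orbitOf {α : Q.V → ℕ} (V : QRep Q α) : Set (QRep Q α) := {W | ∃ g : GLb α, gAct g V = W}

/-- `C` is an orbit closure `closure(GL(α)·V)` of some module `V ∈ mod(A,α)`. -/
def IsOrbitClosure (S : Set (FormalRel Q)) {α : Q.V → ℕ} (C : Set (QRep Q α)) : Prop :=
  ∃ V ∈ modSet S α, C = zclosure (orbitOf V)

/-- The coordinates on `∏_x ℂ^{α(x) × α(x)}`, the ambient space of `GL(α)`. -/
def glCoords {α : Q.V → ℕ} (g : ∀ x : Q.V, Matrix (Fin (α x)) (Fin (α x)) ℂ) :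
    (Σ x : Q.V, Fin (α x) × Fin (α x)) → ℂ := fun c => g c.1 c.2.1 c.2.2

/-- The Zariski topology on `∏_x ℂ^{α(x) × α(x)}`. -/
def glTop (Q : Quiv) (α : Q.V → ℕ) :
    TopologicalSpace (∀ x : Q.V, Matrix (Fin (α x)) (Fin (α x)) ℂ) :=
  TopologicalSpace.induced glCoords (zarPi _)

/-- `GL(α)` as a (quasi-affine) subset of `∏_x ℂ^{α(x) × α(x)}`. -/
def glSet (Q : Quiv) (α : Q.V → ℕ) : Set (∀ x : Q.V, Matrix (Fin (α x)) (Fin (α x)) ℂ) :=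
  {g | ∀ x, IsUnit (g x)}

/-- The dimension of the group variety `GL(α)`. -/
def glDim (Q : Quiv) (α : Q.V → ℕ) : WithBot ℕ∞ :=
  @topologicalKrullDim (glSet Q α) (TopologicalSpace.induced Subtype.val (glTop Q α))

end Zariski
section Sums

variable {Q : Quiv}

/-- `W` is a direct sum of the representations `V i` (up to isomorphism of the underlying
block-diagonal structure). -/
def IsSumOf {ι : Type} [Fintype ι] [DecidableEq ι] {αs : ι → Q.V → ℕ} {δ : Q.V → ℕ}
    (W : QRep Q δ) (V : ∀ i, QRep Q (αs i)) : Prop :=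
  ∃ u : ∀ x : Q.V, ((Fin (δ x) → ℂ) ≃ₗ[ℂ] ((Σ i, Fin (αs i x)) → ℂ)),
    ∀ a : Q.A, (u (Q.h a)).toLinearMap ∘ₗ (W a).mulVecLin =
      (Matrix.blockDiagonal' (fun i => V i a)).mulVecLin ∘ₗ (u (Q.t a)).toLinearMap

/-- The constructible subset `C₁ ⊕ ⋯ ⊕ C_l ⊆ rep(Q,δ)`: representations isomorphic to a
direct sum `V₁ ⊕ ⋯ ⊕ V_l` with `V_i ∈ C_i`. -/
def sumSet {ι : Type} [Fintype ι] [DecidableEq ι] (αs : ι → Q.V → ℕ)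
    (Cs : ∀ i, Set (QRep Q (αs i))) (δ : Q.V → ℕ) : Set (QRep Q δ) :=
  {W | ∃ V : ∀ i, QRep Q (αs i), (∀ i, V i ∈ Cs i) ∧ IsSumOf W V}

/-- The generic `Ext¹` between two subsets:
`ext¹(C,D) = min {dim Ext¹(X,Y) : (X,Y) ∈ C × D}`. -/
def genExt1 (S : Set (FormalRel Q)) {α α' : Q.V → ℕ}
    (C : Set (QRep Q α)) (D : Set (QRep Q α')) : ℕ :=
  sInf {n : ℕ | ∃ X ∈ C, ∃ Y ∈ D, n = dimExt1 S X Y}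

end Sums

section ExtHigher

variable {Q : Quiv}

/-- A representation of `Q` packaged with its dimension vector. -/
def PRp (Q : Quiv) := Σ γ : Q.V → ℕ, QRep Q γ

instance : Inhabited (PRp Q) := ⟨⟨fun _ => 0, fun _ => 0⟩⟩

/-- `K` is a (first) syzygy of `M` over `ℂQ/⟨S⟩`: there is a short exact sequence
`0 → K → P → M → 0` with `P` a projective module. -/
def IsSyzOf (S : Set (FormalRel Q)) (K M : PRp Q) : Prop :=
  K.2 ∈ modSet S K.1 ∧ ∃ (γP : Q.V → ℕ) (P : QRep Q γP), P ∈ modSet S γP ∧ IsProjRep S P ∧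
    ∃ i ∈ HomS K.2 P, ∃ p ∈ HomS P M.2, MorInj i ∧ MorSurj p ∧
      ∀ x, LinearMap.range (Matrix.mulVecLin (i x)) = LinearMap.ker (Matrix.mulVecLin (p x))

/-- A chosen syzygy of `M` over `ℂQ/⟨S⟩`. -/
def syz (S : Set (FormalRel Q)) (M : PRp Q) : PRp Q :=
  Classical.epsilon (fun K => IsSyzOf S K M)

/-- `dim_ℂ Ext^l (M,N)` over `ℂQ/⟨S⟩`, via dimension shifting along syzygies:
`Ext⁰ = Hom`, `Ext¹` is computed by cochains, and `Ext^{l+2}(M,N) = Ext^{l+1}(ΩM,N)`. -/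
def dimExtN (S : Set (FormalRel Q)) : ℕ → PRp Q → PRp Q → ℕ
  | 0, M, N => dimHom M.2 N.2
  | 1, M, N => dimExt1 S M.2 N.2
  | (l+2), M, N => dimExtN S (l+1) (syz S M) N

/-- The simple representation `S_x` concentrated at the vertex `x`. -/
def simplePR (Q : Quiv) (x0 : Q.V) : PRp Q :=
  ⟨fun z => if z = x0 then 1 else 0, fun _ => 0⟩

/-- The Euler form pairing `⟨α, dim S_y⟩_B` of the algebra `B = ℂQ/⟨S⟩`:
`Σ_{l ≥ 0} (−1)^l Σ_x dim Ext^l_B(S_x,S_y) · α(x)`.  The weight `⟨α,−⟩_B` is the function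
`y ↦ eulerPair S α y`. -/
def eulerPair (S : Set (FormalRel Q)) (α : Q.V → ℕ) (y : Q.V) : ℤ :=
  ∑ᶠ l : ℕ, (-1 : ℤ)^l *
    ∑ x : Q.V, (α x : ℤ) * (dimExtN S l (simplePR Q x) (simplePR Q y) : ℤ)

/-- The set of relations annihilating `W`: the annihilator `Ann_{ℂQ}(W)`, so that
`B = ℂQ/Ann_{ℂQ}(W)`. -/
def annRel {β : Q.V → ℕ} (W : QRep Q β) : Set (FormalRel Q) :=
  {r | evalLin W r.2.2 = 0}

/-- The weight semigroup `L_W` of `W`: weights `σ` with `σ|_{supp β} = ⟨α,−⟩_B` for some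
dimension vector `α ∈ ℕ^{supp β}` with `P_B(α) ≠ ∅`, where `B = ℂQ/Ann_{ℂQ}(W)`. -/
def weightSgrp {β : Q.V → ℕ} (W : QRep Q β) : Set (Q.V → ℤ) :=
  {σ | ∃ α : Q.V → ℕ, (∀ x, β x = 0 → α x = 0) ∧ (PAset (annRel W) α).Nonempty ∧
    ∀ y, β y ≠ 0 → σ y = eulerPair (annRel W) α y}

end ExtHigher

section Tame

variable {Q : Quiv}

/-- Specialization of a representation over `ℂ[x]` at `λ ∈ ℂ`, i.e.
`M ⊗_{ℂ[x]} ℂ[x]/(x−λ)`. -/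
def polyEvalAt {γ : Q.V → ℕ} (M : RepR Q (Polynomial ℂ) γ) (lam : ℂ) : QRep Q γ :=
  fun a => (M a).map (fun p => Polynomial.eval lam p)

/-- The algebra `A = ℂQ/⟨S⟩` is tame: for every dimension `d` there are finitely many
`A`–`ℂ[x]`-bimodules `M₁,…,M_s`, free of finite rank over `ℂ[x]` (i.e. matrix
representations over `ℂ[x]` satisfying the relations), such that all but finitely many
isomorphism classes of `d`-dimensional indecomposable `A`-modules are of the form
`M_i ⊗_{ℂ[x]} ℂ[x]/(x−λ)`. -/
def IsTame (S : Set (FormalRel Q)) : Prop :=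
  ∀ d : ℕ, ∃ (s : ℕ) (γs : Fin s → (Q.V → ℕ)) (M : ∀ i, RepR Q (Polynomial ℂ) (γs i)),
    (∀ i, ∀ r ∈ S, evalLinP (M i) r.2.2 = 0) ∧
    ∃ (t : ℕ) (βs : Fin t → (Q.V → ℕ)) (E : ∀ k, QRep Q (βs k)),
      ∀ (α : Q.V → ℕ) (V : QRep Q α), V ∈ modSet S α → (∑ x, α x) = d → IsIndecRep V →
        (∃ k, RIso (E k) V) ∨ (∃ i lam, RIso (polyEvalAt (M i) lam) V)

end Tame

section Stability

variable {Q : Quiv}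

/-- `U` is a subrepresentation of `V` (a family of subspaces preserved by the structure
maps). -/
def SubRep {α : Q.V → ℕ} (V : QRep Q α) (U : ∀ x : Q.V, Submodule ℂ (Fin (α x) → ℂ)) : Prop :=
  ∀ a : Q.A, (U (Q.t a)).map (Matrix.mulVecLin (V a)) ≤ U (Q.h a)

/-- `V` is `θ`-stable: `V ≠ 0`, `θ · dim V = 0`, and `θ · dim V' < 0` for every proper
nonzero subrepresentation `V'` of `V`. -/
def ThetaStable {α : Q.V → ℕ} (θ : Q.V → ℤ) (V : QRep Q α) : Prop :=
  (∃ x, α x ≠ 0) ∧ (∑ x, θ x * (α x : ℤ)) = 0 ∧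
  ∀ U : ∀ x : Q.V, Submodule ℂ (Fin (α x) → ℂ), SubRep V U →
    (∃ x, U x ≠ ⊥) → (∃ x, U x ≠ ⊤) →
      (∑ x, θ x * (Module.finrank ℂ (U x) : ℤ)) < 0

/-- The morphism with components `f` from `P` is essential onto its image: any
subrepresentation of `P` mapping onto the image of `f` is all of `P`. -/
def IsEssentialTo {γ δ : Q.V → ℕ} (P : QRep Q γ)
    (f : ∀ x : Q.V, Matrix (Fin (δ x)) (Fin (γ x)) ℂ) : Prop :=
  ∀ U : ∀ x : Q.V, Submodule ℂ (Fin (γ x) → ℂ), SubRep P U →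
    (∀ x, (U x).map (Matrix.mulVecLin (f x)) = LinearMap.range (Matrix.mulVecLin (f x))) →
      ∀ x, U x = ⊤

end Stability

section Ideal

variable {Q : Quiv}

/-- The `(x,y)`-component of the two-sided ideal `⟨S⟩` of `ℂQ` generated by the
relations in `S`: the span of the translates `q·r·p` of relations `r ∈ S` by paths. -/
def idealComp (S : Set (FormalRel Q)) (x y : Q.V) : Submodule ℂ (Quiver.Path x y →₀ ℂ) :=
  Submodule.span ℂ {c | ∃ r ∈ S, ∃ (p : Quiver.Path x r.1) (q : Quiver.Path r.2.1 y),
    c = Finsupp.mapDomain (fun s => (p.comp s).comp q) r.2.2}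

/-- `W` is a faithful module over `A = ℂQ/⟨S⟩`: every element of `ℂQ` annihilating `W`
lies in the ideal `⟨S⟩`. -/
def FaithfulOver (S : Set (FormalRel Q)) {β : Q.V → ℕ} (W : QRep Q β) : Prop :=
  ∀ (x y : Q.V) (c : Quiver.Path x y →₀ ℂ), evalLin W c = 0 → c ∈ idealComp S x y

end Ideal
section Precomp

variable {Q : Quiv}

/-- Precomposition with a morphism `f : L → M` of representations, as a linear map
`Hom(M,N) → Hom(L,N)`, `φ ↦ φ ∘ f`. -/
def precompMap {γ₁ γ₀ δ : Q.V → ℕ} (L : QRep Q γ₁) (M : QRep Q γ₀) (N : QRep Q δ)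
    (f : ∀ x : Q.V, Matrix (Fin (γ₀ x)) (Fin (γ₁ x)) ℂ) (hf : f ∈ HomS L M) :
    (HomS M N) →ₗ[ℂ] (HomS L N) where
  toFun φ := ⟨fun x => φ.1 x * f x, by
    intro a
    have h1 : φ.1 (Q.h a) * M a = N a * φ.1 (Q.t a) := φ.2 a
    have h2 : f (Q.h a) * L a = M a * f (Q.t a) := hf a
    calc (φ.1 (Q.h a) * f (Q.h a)) * L a
        = φ.1 (Q.h a) * (f (Q.h a) * L a) := by rw [Matrix.mul_assoc]
      _ = φ.1 (Q.h a) * (M a * f (Q.t a)) := by rw [h2]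
      _ = (φ.1 (Q.h a) * M a) * f (Q.t a) := by rw [Matrix.mul_assoc]
      _ = (N a * φ.1 (Q.t a)) * f (Q.t a) := by rw [h1]
      _ = N a * (φ.1 (Q.t a) * f (Q.t a)) := by rw [Matrix.mul_assoc]⟩
  map_add' φ ψ := by
    apply Subtype.ext
    funext x
    simp [Matrix.add_mul]
  map_smul' c φ := by
    apply Subtype.ext
    funext x
    simp [Matrix.smul_mul]

end Precomp

section BipartiteQsig

variable (Q : Quiv) (β : Q.V → ℕ) (σ : Q.V → ℤ)

/-- The bipartite quiver `Q^σ`: its vertices are the vertices of `Q` where `σ` is positive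
together with those where `σ` is negative, and it has one arrow `a_p : v_i → w_j` for every
oriented path `p` in `Q` from `v_i` to `w_j`. -/
def Qsig : Quiv where
  V := PosV Q σ ⊕ NegV Q σ
  A := Σ (i : PosV Q σ) (j : NegV Q σ), Quiver.Path i.1 j.1
  t := fun a => Sum.inl a.1
  h := fun a => Sum.inr a.2.1
  fV := inferInstance
  dV := inferInstance

/-- The dimension vector `β` restricted to `Q^σ`. -/
def betaSig : (Qsig Q σ).V → ℕ := Sum.elim (fun i => β i.1) (fun j => β j.1)

/-- The weight `σ` restricted to `Q^σ`. -/
def sigSig : (Qsig Q σ).V → ℤ := Sum.elim (fun i => σ i.1) (fun j => σ j.1)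

/-- The morphism `φ : rep(Q,β) → rep(Q^σ,β)` given by `φ(W)(a_p) = W(p)`. -/
def phiSig (W : QRep Q β) : QRep (Qsig Q σ) (betaSig Q β σ) :=
  fun a => evalPath W a.2.2

end BipartiteQsig

section PathAlgebra

lemma evalPath_comp {R : Type} [CommRing R] {β : Q.V → ℕ} (W : RepR Q R β) {x y z : Q.V}
    (p : Quiver.Path x y) (q : Quiver.Path y z) :
    evalPath W (p.comp q) = evalPath W q * evalPath W p := by
  induction q with
  | nil => simp [evalPath]
  | cons q e ih => simp [evalPath, ih, Matrix.mul_assoc]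

/-- Formal linear combinations of paths from `x` to `y`. -/
abbrev PathComb (x y : Q.V) := Quiver.Path x y →₀ ℂ

/-- `evalLin` as a linear map. -/
def evalMap {β : Q.V → ℕ} (W : QRep Q β) (x y : Q.V) :
    PathComb x y →ₗ[ℂ] Matrix (Fin (β y)) (Fin (β x)) ℂ :=
  Finsupp.linearCombination ℂ (fun p => evalPath W p)

lemma evalMap_apply {β : Q.V → ℕ} (W : QRep Q β) {x y : Q.V} (c : PathComb x y) :
    evalMap W x y c = evalLin W c := rfl

lemma evalLin_single {β : Q.V → ℕ} (W : QRep Q β) {x y : Q.V} (p : Quiver.Path x y) (k : ℂ) :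
    evalLin W (Finsupp.single p k) = k • evalPath W p := by
  simp [evalLin]

/-- The product in the path algebra (`d` first, then `c`). -/
def pathMul {x y z : Q.V} (c : PathComb y z) (d : PathComb x y) : PathComb x z :=
  c.sum fun p k => d.sum fun q l => Finsupp.single (q.comp p) (k * l)

lemma evalLin_pathMul {β : Q.V → ℕ} (W : QRep Q β) {x y z : Q.V} (c : PathComb y z)
    (d : PathComb x y) : evalLin W (pathMul c d) = evalLin W c * evalLin W d := by
  rw [← evalMap_apply, pathMul]
  simp only [Finsupp.sum, map_sum, evalMap_apply, evalLin_single]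
  simp only [evalLin, Finsupp.sum, Matrix.sum_mul, Matrix.mul_sum, evalPath_comp,
    Matrix.smul_mul, Matrix.mul_smul, mul_smul, Finset.smul_sum]
  rw [Finset.sum_comm]
  exact Finset.sum_congr rfl fun q _ => Finset.sum_congr rfl fun p _ => smul_comm _ _ _

variable {I J K L : Type}

/-- Block matrices of path combinations with columns starting at `xs` and rows ending at `ys`. -/
abbrev PathBlock (xs : I → Q.V) (ys : J → Q.V) := ∀ j i, PathComb (xs i) (ys j)

/-- Evaluation of a block matrix of path combinations on a representation. -/
def blk {γ : Q.V → ℕ} (V : QRep Q γ) {xs : I → Q.V} {ys : J → Q.V} :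
    PathBlock xs ys →ₗ[ℂ] Matrix (Σ j, Fin (γ (ys j))) (Σ i, Fin (γ (xs i))) ℂ where
  toFun f := fun r c => evalLin V (f r.1 c.1) r.2 c.2
  map_add' f g := by
    ext r c
    simp only [Pi.add_apply, ← evalMap_apply, map_add, Matrix.add_apply]
    rfl
  map_smul' k f := by
    ext r c
    simp only [Pi.smul_apply, ← evalMap_apply, map_smul, Matrix.smul_apply, RingHom.id_apply]
    rfl

lemma blk_apply {γ : Q.V → ℕ} (V : QRep Q γ) {xs : I → Q.V} {ys : J → Q.V}
    (f : PathBlock xs ys) (r c) : blk V f r c = evalLin V (f r.1 c.1) r.2 c.2 := rfl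

/-- The product of block matrices of path combinations. -/
def blkMul [Fintype J] {xs : I → Q.V} {ys : J → Q.V} {zs : K → Q.V} (a : PathBlock ys zs)
    (f : PathBlock xs ys) : PathBlock xs zs :=
  fun k i => ∑ j, pathMul (a k j) (f j i)

lemma blk_blkMul [Fintype J] {γ : Q.V → ℕ} (V : QRep Q γ) {xs : I → Q.V} {ys : J → Q.V}
    {zs : K → Q.V} (a : PathBlock ys zs) (f : PathBlock xs ys) :
    blk V (blkMul a f) = blk V a * blk V f := by
  ext r c
  rw [blk_apply, blkMul, ← evalMap_apply, map_sum, Matrix.mul_apply, Fintype.sum_sigma,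
    Matrix.sum_apply]
  simp only [evalMap_apply, evalLin_pathMul, Matrix.mul_apply, blk_apply]

/-- The identity block matrix. -/
def blkOne [DecidableEq I] (xs : I → Q.V) : PathBlock xs xs :=
  fun j i => if h : i = j then h ▸ Finsupp.single Quiver.Path.nil 1 else 0

lemma blk_blkOne [DecidableEq I] {γ : Q.V → ℕ} (V : QRep Q γ) (xs : I → Q.V) :
    blk V (blkOne xs) = 1 := by
  ext ⟨j, r⟩ ⟨i, c⟩
  rw [blk_apply, blkOne]
  by_cases h : i = j
  · subst h
    simp [evalLin_single, evalPath, Matrix.one_apply]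
  · have : ¬ (j = i) := fun e => h e.symm
    simp [h, this, evalLin]

end PathAlgebra

section Pencils

variable {X Y : Type*} [AddCommGroup X] [Module ℂ X] [AddCommGroup Y] [Module ℂ Y]

lemma finite_not_isUnit_one_add_smul [FiniteDimensional ℂ Y] (S : Module.End ℂ Y) :
    {t : ℂ | ¬ IsUnit (1 + t • S)}.Finite := by
  have h := (Module.End.finite_spectrum S).preimage (f := fun t : ℂ => -t⁻¹)
    (fun a _ b _ hab => inv_injective (neg_injective hab))
  refine h.subset fun t ht => ?_
  have ht0 : t ≠ 0 := by
    rintro rfl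
    simp at ht
  simp only [Set.mem_preimage, spectrum.mem_iff]
  intro hu
  apply ht
  have : 1 + t • S = (-t) • (algebraMap ℂ (Module.End ℂ Y) (-t⁻¹) - S) := by
    rw [Algebra.algebraMap_eq_smul_one, smul_sub, smul_smul, neg_mul_neg, mul_inv_cancel₀ ht0]
    simp
  rw [this]
  exact hu.smul (Units.mk0 (-t) (neg_ne_zero.2 ht0))

lemma finite_not_surjective_add_smul [FiniteDimensional ℂ Y] (A B : X →ₗ[ℂ] Y)
    (hA : Function.Surjective A) : {t : ℂ | ¬ Function.Surjective (A + t • B)}.Finite := by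
  obtain ⟨s, hs⟩ := A.exists_rightInverse_of_surjective (LinearMap.range_eq_top.2 hA)
  refine (finite_not_isUnit_one_add_smul (B ∘ₗ s)).subset fun t ht hu => ht ?_
  have h1 : (A + t • B) ∘ₗ s = 1 + t • (B ∘ₗ s) := by
    rw [LinearMap.add_comp, hs, LinearMap.smul_comp]
    rfl
  have h2 : Function.Surjective ((A + t • B) ∘ₗ s) := by
    rw [h1]
    exact ((Module.End.isUnit_iff _).1 hu).2
  exact Function.Surjective.of_comp h2

lemma finite_not_le_map_add_smul [FiniteDimensional ℂ Y] (A B : X →ₗ[ℂ] Y)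
    (E : Submodule ℂ X) (F : Submodule ℂ Y) (hAE : E.map A = F) (hBE : E.map B ≤ F) :
    {t : ℂ | ¬ F ≤ E.map (A + t • B)}.Finite := by
  have hA : ∀ x ∈ E, A x ∈ F := fun x hx => hAE ▸ Submodule.mem_map_of_mem hx
  have hB : ∀ x ∈ E, B x ∈ F := fun x hx => hBE (Submodule.mem_map_of_mem hx)
  refine (finite_not_surjective_add_smul (A.restrict hA) (B.restrict hB) ?_).subset
    fun t ht hs => ht fun y hy => ?_
  · rintro ⟨y, hy⟩
    rw [← hAE] at hy
    obtain ⟨x, hx, rfl⟩ := hy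
    exact ⟨⟨x, hx⟩, rfl⟩
  · obtain ⟨⟨x, hx⟩, hxy⟩ := hs ⟨y, hy⟩
    exact ⟨x, hx, congrArg Subtype.val hxy⟩

lemma finite_not_le_map_add_smul_of_filtration [FiniteDimensional ℂ Y] (A B : X →ₗ[ℂ] Y)
    {E₀ E : Submodule ℂ X} {F₀ F : Submodule ℂ Y} (hE : E₀ ≤ E)
    (hA₀ : E₀.map A = F₀) (hB₀ : E₀.map B ≤ F₀) (hA : E.map A ≤ F) (hB : E.map B ≤ F)
    (hF : F ≤ F₀ ⊔ E.map B) : {t : ℂ | ¬ F ≤ E.map (A + t • B)}.Finite := by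
  have h1 := finite_not_le_map_add_smul A B E₀ F₀ hA₀ hB₀
  have h2 := finite_not_le_map_add_smul (F₀.mkQ ∘ₗ B) (F₀.mkQ ∘ₗ A) E (F.map F₀.mkQ) (by
    refine le_antisymm ?_ ?_
    · rw [Submodule.map_comp]
      exact Submodule.map_mono hB
    · rw [Submodule.map_comp]
      refine (Submodule.map_mono hF).trans ?_
      rw [Submodule.map_sup]
      simp) (by
    rw [Submodule.map_comp]
    exact Submodule.map_mono hA)
  have h3 := h2.preimage (f := fun t : ℂ => t⁻¹) (fun a _ b _ hab => inv_injective hab)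
  refine ((h1.union h3).union (Set.finite_singleton 0)).subset fun t ht => ?_
  by_contra hcon
  simp only [Set.mem_union, Set.mem_ofPred_eq, Set.mem_preimage, Set.mem_singleton_iff, not_or,
    not_not] at hcon
  obtain ⟨⟨c1, c2⟩, c3⟩ := hcon
  refine ht fun y hy => ?_
  obtain ⟨x, hx, hxy⟩ := c2 (Submodule.mem_map_of_mem hy)
  have hmem : y - (A + t • B) (t⁻¹ • x) ∈ F₀ := by
    rw [← F₀.ker_mkQ, LinearMap.mem_ker, map_sub, ← hxy, sub_eq_zero]
    simp only [LinearMap.add_apply, LinearMap.smul_apply, LinearMap.comp_apply, map_add, map_smul,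
      smul_add, smul_smul, inv_mul_cancel₀ c3, one_smul]
    rw [add_comm]
  obtain ⟨x0, hx0, hx0y⟩ := c1 hmem
  refine ⟨x0 + t⁻¹ • x, E.add_mem (hE hx0) (E.smul_mem _ hx), ?_⟩
  rw [map_add, hx0y, sub_add_cancel]

lemma exists_eq_top_of_infinitesimal [FiniteDimensional ℂ Y] (P : ℂ → Submodule ℂ Y)
    (h : ∀ y, ∃ s, ∀ t ≠ 0, y + t • s ∈ P t) : ∃ t ≠ 0, P t = ⊤ := by
  choose s hs using h
  let b := Module.finBasis ℂ Y
  let S : Module.End ℂ Y := b.constr ℂ fun i => s (b i)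
  have hS : ∀ t ≠ 0, ∀ y, (1 + t • S) y ∈ P t := by
    intro t ht y
    rw [← b.sum_repr y, map_sum]
    refine Submodule.sum_mem _ fun i _ => ?_
    rw [map_smul]
    refine Submodule.smul_mem _ _ ?_
    have := hs (b i) t ht
    simpa [S, Module.Basis.constr_basis] using this
  have hfin := (finite_not_isUnit_one_add_smul S).union (Set.finite_singleton (0 : ℂ))
  obtain ⟨t, ht⟩ := hfin.infinite_compl.nonempty
  simp only [Set.mem_compl_iff, Set.mem_union, Set.mem_ofPred_eq, Set.mem_singleton_iff, not_or,
    not_not] at ht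
  refine ⟨t, ht.2, eq_top_iff.2 fun y _ => ?_⟩
  obtain ⟨x, rfl⟩ := ((Module.End.isUnit_iff _).1 ht.1).2 y
  exact hS t ht.2 x

end Pencils

section Derivations

open TensorProduct in
lemma exists_derivation_extension (K S T : Type*) [CommRing K] [CommRing S] [CommRing T]
    [Algebra K S] [Algebra K T] [Algebra S T] [IsScalarTower K S T] [Algebra.FormallyEtale S T]
    (d : Derivation K S T) : ∃ D : Derivation K T T, ∀ s, D (algebraMap S T s) = d s := by
  let e := KaehlerDifferential.tensorKaehlerEquivOfFormallyEtale K S T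
  let l : Ω[T⁄K] →ₗ[T] T := (d.liftKaehlerDifferential.liftBaseChange T) ∘ₗ e.symm.toLinearMap
  refine ⟨l.compDer (KaehlerDifferential.D K T), fun s => ?_⟩
  change (d.liftKaehlerDifferential.liftBaseChange T)
    (e.symm (KaehlerDifferential.D K T (algebraMap S T s))) = d s
  rw [KaehlerDifferential.tensorKaehlerEquivOfFormallyEtale_symm_D_algebraMap]
  simp

open IntermediateField.algebraAdjoinAdjoin in
lemma exists_derivation_of_isTranscendenceBasis {K E ι : Type} [Field K] [Field E] [CharZero K]
    [Algebra K E] {x : ι → E} (hx : IsTranscendenceBasis K x) (c : ι → E) :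
    ∃ D : Derivation K E E, ∀ i, D (x i) = c i := by
  let S := Algebra.adjoin K (Set.range x)
  let F := IntermediateField.adjoin K (Set.range x)
  have : Algebra.IsAlgebraic F E := hx.isAlgebraic_field
  have h1 : Algebra.FormallyEtale S F := .of_isLocalization (nonZeroDivisors S)
  have h2 : Algebra.FormallyEtale F E := .of_isSeparable F E
  have h3 : Algebra.FormallyEtale S E := .comp S F E
  let e : MvPolynomial ι K ≃ₐ[K] S := hx.1.aevalEquiv
  let _ : Module (MvPolynomial ι K) E := Module.compHom E (e : MvPolynomial ι K →+* S)
  have hsm : ∀ (p : MvPolynomial ι K) (y : E), p • y = e p • y := fun _ _ => rfl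
  have : IsScalarTower K (MvPolynomial ι K) E := ⟨fun k p y => by
    rw [hsm, hsm, map_smul, smul_assoc]⟩
  let dP : Derivation K (MvPolynomial ι K) E := MvPolynomial.mkDerivation K c
  let d : Derivation K S E := Derivation.mk' (dP.toLinearMap ∘ₗ e.symm.toLinearMap) (by
    intro a b
    simp [hsm])
  obtain ⟨D, hD⟩ := exists_derivation_extension K S E d
  refine ⟨D, fun i => ?_⟩
  have h4 : x i = algebraMap S E (e (MvPolynomial.X i)) := by
    have := hx.1.algebraMap_aevalEquiv (MvPolynomial.X i)
    rw [MvPolynomial.aeval_X] at this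
    exact this.symm
  rw [h4, hD]
  change dP (e.symm (e (MvPolynomial.X i))) = c i
  rw [e.symm_apply_apply]
  exact MvPolynomial.mkDerivation_X _ _ _

/-- The derivations of `ℂ` that vanish on `T`. -/
def derivationsKilling (T : Set ℂ) : Submodule ℂ (Derivation ℤ ℂ ℂ) where
  carrier := {D | ∀ a ∈ T, D a = 0}
  add_mem' hD hD' a ha := by simp [hD a ha, hD' a ha]
  zero_mem' a _ := rfl
  smul_mem' k D hD a ha := by simp [hD a ha]

lemma exists_generic_point {T : Set ℂ} (hT : T.Countable) (ι : Type) [Finite ι] :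
    ∃ z : ι → ℂ, ∀ c : ι → ℂ, ∃ D ∈ derivationsKilling T, ∀ i, D (z i) = c i := by
  let K := Subfield.closure T
  have hK : Cardinal.mk K ≤ Cardinal.aleph0 :=
    (Subfield.cardinalMk_closure_le_max T).trans (max_le hT.le_aleph0 le_rfl)
  obtain ⟨s, hs⟩ := exists_isTranscendenceBasis K ℂ
  have hcard := IsAlgClosed.cardinal_eq_cardinal_transcendence_basis_of_aleph0_lt _ hs hK
    (by rw [Cardinal.mk_complex]; exact Cardinal.aleph0_lt_continuum)
  have : Infinite s := by
    rw [← Cardinal.aleph0_le_mk_iff]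
    have := Cardinal.lift_inj.1 hcard
    rw [← this, Cardinal.mk_complex]
    exact Cardinal.aleph0_le_continuum
  have : Countable ι := Finite.to_countable
  obtain ⟨φ⟩ : Nonempty (ι ↪ s) := by
    obtain ⟨f, hf⟩ := exists_injective_nat ι
    exact ⟨(⟨f, hf⟩ : ι ↪ ℕ).trans (Infinite.natEmbedding s)⟩
  refine ⟨fun i => (φ i : ℂ), fun c => ?_⟩
  obtain ⟨D, hD⟩ := exists_derivation_of_isTranscendenceBasis hs (Function.extend φ c 0)
  refine ⟨D.restrictScalars ℤ, fun a ha => ?_, fun i => ?_⟩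
  · exact D.map_algebraMap (⟨a, Subfield.subset_closure ha⟩ : K)
  · exact (hD (φ i)).trans (φ.injective.extend_apply c 0 i)

end Derivations

section Modules

lemma evalPath_cons_mk {R : Type} [CommRing R] {β : Q.V → ℕ} (W : RepR Q R β) {x : Q.V}
    (a : Q.A) (p : Quiver.Path x (Q.t a)) :
    evalPath W (p.cons (⟨a, rfl, rfl⟩ : Q.t a ⟶ Q.h a)) = W a * evalPath W p := by
  simp [evalPath, castM]

lemma evalLin_mulVec {β : Q.V → ℕ} (W : QRep Q β) {x y : Q.V} (c : PathComb x y)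
    (v : Fin (β x) → ℂ) :
    evalLin W c *ᵥ v = c.sum fun p k => k • (evalPath W p *ᵥ v) := by
  simp only [evalLin, Finsupp.sum, Matrix.sum_mulVec, Matrix.smul_mulVec]

lemma evalPath_mulVec_intertwine {α γ : Q.V → ℕ} (N : QRep Q α) (V : QRep Q γ)
    (p : ∀ z, (Fin (α z) → ℂ) →ₗ[ℂ] (Fin (γ z) → ℂ))
    (hp : ∀ a v, p (Q.h a) (N a *ᵥ v) = V a *ᵥ p (Q.t a) v) {x y : Q.V}
    (r : Quiver.Path x y) (v : Fin (α x) → ℂ) :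
    p y (evalPath N r *ᵥ v) = evalPath V r *ᵥ p x v := by
  induction r with
  | nil => simp [evalPath]
  | cons r e ih =>
    obtain ⟨a, rfl, rfl⟩ := e
    rw [evalPath_cons_mk, evalPath_cons_mk, ← Matrix.mulVec_mulVec, hp, ih, Matrix.mulVec_mulVec]

lemma evalLin_mulVec_intertwine {α γ : Q.V → ℕ} (N : QRep Q α) (V : QRep Q γ)
    (p : ∀ z, (Fin (α z) → ℂ) →ₗ[ℂ] (Fin (γ z) → ℂ))
    (hp : ∀ a v, p (Q.h a) (N a *ᵥ v) = V a *ᵥ p (Q.t a) v) {x y : Q.V}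
    (c : PathComb x y) (v : Fin (α x) → ℂ) :
    p y (evalLin N c *ᵥ v) = evalLin V c *ᵥ p x v := by
  simp only [evalLin_mulVec, Finsupp.sum, map_sum, map_smul, evalPath_mulVec_intertwine N V p hp]

/-- A row of path combinations acting on a tuple of vectors. -/
def rowAct {I : Type} [Fintype I] {xs : I → Q.V} {γ : Q.V → ℕ} (V : QRep Q γ) {z : Q.V}
    (u : ∀ i, PathComb (xs i) z) (m : ∀ i, Fin (γ (xs i)) → ℂ) : Fin (γ z) → ℂ :=
  ∑ i, evalLin V (u i) *ᵥ m i

/-- A morphism from `N` to some representation. -/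
structure RepQuot {α : Q.V → ℕ} (N : QRep Q α) where
  dim : Q.V → ℕ
  rep : QRep Q dim
  map : ∀ z, (Fin (α z) → ℂ) →ₗ[ℂ] (Fin (dim z) → ℂ)
  comm : ∀ a v, map (Q.h a) (N a *ᵥ v) = rep a *ᵥ map (Q.t a) v

/-- Composition of morphisms. -/
def RepQuot.comp {α : Q.V → ℕ} {N : QRep Q α} (X : RepQuot N) (Y : RepQuot X.rep) :
    RepQuot N where
  dim := Y.dim
  rep := Y.rep
  map z := Y.map z ∘ₗ X.map z
  comm a v := by simp [X.comm, Y.comm]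

/-- A family of morphisms out of `N` exhibiting `N` as the product of the targets. -/
def RepQuot.IsProduct {α : Q.V → ℕ} {N : QRep Q α} {κ : Type} (F : κ → RepQuot N) : Prop :=
  ∀ z, Function.Bijective fun (v : Fin (α z) → ℂ) k => (F k).map z v

lemma RepQuot.rep_mem_modSet {α : Q.V → ℕ} {N : QRep Q α} (X : RepQuot N)
    (hX : ∀ z, Function.Surjective (X.map z)) {S : Set (FormalRel Q)} (hN : N ∈ modSet S α) :
    X.rep ∈ modSet S X.dim := by
  intro r hr
  apply Matrix.ext_of_mulVec_single
  intro i
  obtain ⟨v, hv⟩ := hX _ (Pi.single i 1)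
  rw [← hv, ← evalLin_mulVec_intertwine N X.rep X.map X.comm, hN r hr]
  simp

lemma exists_qRep {U : Q.V → Type} [∀ z, AddCommGroup (U z)] [∀ z, Module ℂ (U z)]
    [∀ z, FiniteDimensional ℂ (U z)] (ρ : ∀ a, U (Q.t a) →ₗ[ℂ] U (Q.h a)) :
    ∃ (N : QRep Q fun z => Module.finrank ℂ (U z))
      (b : ∀ z, U z ≃ₗ[ℂ] (Fin (Module.finrank ℂ (U z)) → ℂ)),
      ∀ a u, b (Q.h a) (ρ a u) = N a *ᵥ b (Q.t a) u := by
  let b : ∀ z, U z ≃ₗ[ℂ] (Fin (Module.finrank ℂ (U z)) → ℂ) := fun z =>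
    (Module.finBasis ℂ (U z)).equivFun
  refine ⟨fun a => LinearMap.toMatrix' ((b (Q.h a)).toLinearMap ∘ₗ ρ a ∘ₗ
    (b (Q.t a)).symm.toLinearMap), b, fun a u => ?_⟩
  rw [LinearMap.toMatrix'_mulVec]
  simp

lemma exists_repQuot_of_idempotent {α : Q.V → ℕ} (N : QRep Q α)
    (φ : ∀ x : Q.V, Matrix (Fin (α x)) (Fin (α x)) ℂ) (hφ : φ ∈ HomS N N) :
    ∃ X : RepQuot N, (∀ z, X.dim z = Module.finrank ℂ (LinearMap.range (φ z).mulVecLin)) ∧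
      (∀ z, Function.Surjective (X.map z)) ∧ ∀ z v, X.map z v = 0 ↔ φ z *ᵥ v = 0 := by
  have hmem : ∀ a, ∀ u ∈ LinearMap.range (φ (Q.t a)).mulVecLin,
      (N a).mulVecLin u ∈ LinearMap.range (φ (Q.h a)).mulVecLin := by
    rintro a _ ⟨v, rfl⟩
    refine ⟨N a *ᵥ v, ?_⟩
    simp only [Matrix.mulVecLin_apply, Matrix.mulVec_mulVec]
    rw [hφ a]
  obtain ⟨V, b, hb⟩ := exists_qRep (U := fun z => LinearMap.range (φ z).mulVecLin)
    fun a => (N a).mulVecLin.restrict (hmem a)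
  refine ⟨⟨_, V, fun z => (b z).toLinearMap ∘ₗ (φ z).mulVecLin.rangeRestrict, ?_⟩,
    fun z => rfl, ?_, ?_⟩
  · intro a v
    simp only [LinearMap.comp_apply, LinearEquiv.coe_coe]
    rw [← hb]
    congr 1
    apply Subtype.ext
    change φ (Q.h a) *ᵥ (N a *ᵥ v) = N a *ᵥ (φ (Q.t a) *ᵥ v)
    rw [Matrix.mulVec_mulVec, Matrix.mulVec_mulVec, hφ a]
  · intro z
    exact (b z).surjective.comp (φ z).mulVecLin.surjective_rangeRestrict
  · intro z v
    simp only [LinearMap.comp_apply, LinearEquiv.coe_coe, LinearEquiv.map_eq_zero_iff]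
    rw [← Submodule.coe_eq_zero]
    rfl

/-- A family of indecomposable quotients of `N` exhibiting `N` as their direct sum. -/
def RepQuot.IsDecomposition {α : Q.V → ℕ} {N : QRep Q α} {κ : Type} (F : κ → RepQuot N) : Prop :=
  RepQuot.IsProduct F ∧ ∀ k, IsIndecRep (F k).rep

lemma exists_decomposition (n : ℕ) : ∀ {α : Q.V → ℕ} (N : QRep Q α), ∑ z, α z = n →
    ∃ (κ : Type) (_ : Fintype κ) (F : κ → RepQuot N), RepQuot.IsDecomposition F := by
  induction n using Nat.strong_induction_on with
  | _ n ih =>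
  intro α N hn
  by_cases h0 : ∀ z, α z = 0
  · refine ⟨Empty, inferInstance, Empty.elim, fun z => ?_, fun k => k.elim⟩
    have : IsEmpty (Fin (α z)) := by rw [h0 z]; infer_instance
    exact ⟨fun a b _ => Subsingleton.elim _ _, fun b => ⟨0, Subsingleton.elim _ _⟩⟩
  push Not at h0
  by_cases hind : IsIndecRep N
  · refine ⟨Unit, inferInstance, fun _ => ⟨α, N, fun _ => LinearMap.id, fun _ _ => rfl⟩,
      fun z => ?_, fun _ => hind⟩
    exact ⟨fun a b h => congrFun h (), fun b => ⟨b (), rfl⟩⟩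
  have hsplit : ∃ φ ∈ HomS N N, (∀ x, φ x * φ x = φ x) ∧ φ ≠ 0 ∧
      φ ≠ fun x => (1 : Matrix _ _ ℂ) := by
    by_contra hcon
    push Not at hcon
    exact hind ⟨h0, fun φ h1 h2 => or_iff_not_imp_left.2 (hcon φ h1 h2)⟩
  obtain ⟨φ, hφ, hid, hne0, hne1⟩ := hsplit
  let ψ : ∀ x : Q.V, Matrix (Fin (α x)) (Fin (α x)) ℂ := fun x => 1 - φ x
  have hψ : ψ ∈ HomS N N := fun a => by
    simp only [ψ, Matrix.sub_mul, Matrix.mul_sub, hφ a, Matrix.one_mul, Matrix.mul_one]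
  have hadd : ∀ z v, φ z *ᵥ v + ψ z *ᵥ v = v := fun z v => by
    simp [ψ, ← Matrix.add_mulVec]
  have hφψ : ∀ z v, φ z *ᵥ (ψ z *ᵥ v) = 0 := fun z v => by
    rw [Matrix.mulVec_mulVec, Matrix.mul_sub, hid, Matrix.mul_one, sub_self, Matrix.zero_mulVec]
  have hψφ : ∀ z v, ψ z *ᵥ (φ z *ᵥ v) = 0 := fun z v => by
    rw [Matrix.mulVec_mulVec, Matrix.sub_mul, hid, Matrix.one_mul, sub_self, Matrix.zero_mulVec]
  obtain ⟨X, hXd, hXs, hX0⟩ := exists_repQuot_of_idempotent N φ hφ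
  obtain ⟨Y, hYd, hYs, hY0⟩ := exists_repQuot_of_idempotent N ψ hψ
  have hlt : ∀ (χ : ∀ x : Q.V, Matrix (Fin (α x)) (Fin (α x)) ℂ) (Z : RepQuot N),
      (∀ z, Z.dim z = Module.finrank ℂ (LinearMap.range (χ z).mulVecLin)) →
      (∃ z v, χ z *ᵥ v = 0 ∧ v ≠ 0) → ∑ z, Z.dim z < n := by
    rintro χ Z hZ ⟨z, v, hv, hv0⟩
    rw [← hn]
    refine Finset.sum_lt_sum (fun z _ => ?_) ⟨z, Finset.mem_univ z, ?_⟩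
    · rw [hZ]
      simpa using LinearMap.finrank_range_le (χ z).mulVecLin
    · have h1 := LinearMap.finrank_range_add_finrank_ker (χ z).mulVecLin
      have h2 : 0 < Module.finrank ℂ (LinearMap.ker (χ z).mulVecLin) :=
        Module.finrank_pos_iff_exists_ne_zero.2 ⟨⟨v, hv⟩, fun h => hv0 (congrArg Subtype.val h)⟩
      simp only [Module.finrank_fin_fun] at h1
      rw [hZ]
      omega
  have hXn : ∑ z, X.dim z < n := by
    refine hlt φ X hXd ?_
    by_contra hcon
    push Not at hcon
    refine hne1 (funext fun z => Matrix.ext_of_mulVec_single fun i => ?_)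
    have := hcon z _ (hφψ z (Pi.single i 1))
    rw [← add_zero (φ z *ᵥ _), ← this, hadd, Matrix.one_mulVec]
  have hYn : ∑ z, Y.dim z < n := by
    refine hlt ψ Y hYd ?_
    by_contra hcon
    push Not at hcon
    refine hne0 (funext fun z => Matrix.ext_of_mulVec_single fun i => ?_)
    have := hcon z _ (hψφ z (Pi.single i 1))
    rw [this]
    simp
    rfl
  obtain ⟨κ, _, F, hF, hFi⟩ := ih _ hXn X.rep rfl
  obtain ⟨κ', _, G, hG, hGi⟩ := ih _ hYn Y.rep rfl
  refine ⟨κ ⊕ κ', inferInstance, Sum.elim (fun k => X.comp (F k)) (fun k => Y.comp (G k)),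
    fun z => ⟨?_, ?_⟩, ?_⟩
  · intro v w hvw
    have h1 : X.map z v = X.map z w := (hF z).1 (funext fun k => congrFun hvw (Sum.inl k))
    have h2 : Y.map z v = Y.map z w := (hG z).1 (funext fun k => congrFun hvw (Sum.inr k))
    rw [← sub_eq_zero, ← map_sub, hX0] at h1
    rw [← sub_eq_zero, ← map_sub, hY0] at h2
    rw [← sub_eq_zero, ← hadd z (v - w), h1, h2, add_zero]
  · intro w
    obtain ⟨x, hx⟩ := (hF z).2 fun k => w (Sum.inl k)
    obtain ⟨y, hy⟩ := (hG z).2 fun k => w (Sum.inr k)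
    obtain ⟨x, rfl⟩ := hXs z x
    obtain ⟨y, rfl⟩ := hYs z y
    refine ⟨φ z *ᵥ x + ψ z *ᵥ y, funext fun k => ?_⟩
    have e1 : X.map z (φ z *ᵥ x + ψ z *ᵥ y) = X.map z x := by
      rw [← sub_eq_zero, ← map_sub, hX0, Matrix.mulVec_sub, Matrix.mulVec_add, hφψ, add_zero,
        Matrix.mulVec_mulVec, hid, sub_self]
    have e2 : Y.map z (φ z *ᵥ x + ψ z *ᵥ y) = Y.map z y := by
      have hid' : ψ z * ψ z = ψ z := by simp [ψ, Matrix.mul_sub, Matrix.sub_mul, hid]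
      rw [← sub_eq_zero, ← map_sub, hY0, Matrix.mulVec_sub, Matrix.mulVec_add, hψφ, zero_add,
        Matrix.mulVec_mulVec, hid', sub_self]
    rcases k with k | k
    · exact (congrArg ((F k).map z) e1).trans (congrFun hx k)
    · exact (congrArg ((G k).map z) e2).trans (congrFun hy k)
  · rintro (k | k)
    · exact hFi k
    · exact hGi k

end Modules

section Presentation

variable {I J : Type} [Fintype J]
  {xs : I → Q.V} {ys : J → Q.V} {β : Q.V → ℕ}

/-- Rows of path combinations ending at `z`. -/
abbrev PathRow (xs : I → Q.V) (z : Q.V) := ∀ i, PathComb (xs i) z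

/-- Evaluation of a row of path combinations. -/
def evalRow (W : QRep Q β) (xs : I → Q.V) (z : Q.V) :
    PathRow xs z →ₗ[ℂ] ∀ i, Matrix (Fin (β z)) (Fin (β (xs i))) ℂ :=
  LinearMap.pi fun i => evalMap W (xs i) z ∘ₗ LinearMap.proj i

/-- Left multiples of the block matrix `f`, evaluated on `W`. -/
def leftMultiples (W : QRep Q β) (f : PathBlock xs ys) (z : Q.V) :
    Submodule ℂ (∀ i, Matrix (Fin (β z)) (Fin (β (xs i))) ℂ) where
  carrier := {X | ∃ v : PathRow ys z, ∀ i, X i = ∑ j, evalLin W (v j) * evalLin W (f j i)}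
  add_mem' := by
    rintro X Y ⟨v, hv⟩ ⟨w, hw⟩
    refine ⟨v + w, fun i => ?_⟩
    simp only [Pi.add_apply, hv, hw, ← evalMap_apply, map_add, Matrix.add_mul,
      Finset.sum_add_distrib]
  zero_mem' := ⟨0, fun i => by simp [← evalMap_apply]⟩
  smul_mem' := by
    rintro c X ⟨v, hv⟩
    refine ⟨c • v, fun i => ?_⟩
    simp only [Pi.smul_apply, hv, ← evalMap_apply, map_smul, Matrix.smul_mul, Finset.smul_sum]

/-- Rows whose evaluation on `W` is a left multiple of `f`. -/
abbrev relRows (W : QRep Q β) (f : PathBlock xs ys) (z : Q.V) : Submodule ℂ (PathRow xs z) :=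
  (leftMultiples W f z).comap (evalRow W xs z)

instance finiteDimensional_quotient_relRows [Finite I] (W : QRep Q β) (f : PathBlock xs ys)
    (z : Q.V) : FiniteDimensional ℂ (PathRow xs z ⧸ relRows W f z) := by
  refine FiniteDimensional.of_injective
    ((relRows W f z).mapQ (leftMultiples W f z) (evalRow W xs z) le_rfl) ?_
  rw [← LinearMap.ker_eq_bot, Submodule.ker_mapQ]
  exact (relRows W f z).mkQ_map_self

/-- Composition of all paths in a row with a given path. -/
def pathShift {y z : Q.V} (p : Quiver.Path y z) : PathRow xs y →ₗ[ℂ] PathRow xs z :=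
  LinearMap.pi fun i => Finsupp.lmapDomain ℂ ℂ (fun r => r.comp p) ∘ₗ LinearMap.proj i

lemma evalLin_pathShift (W : QRep Q β) {y z : Q.V} (p : Quiver.Path y z) (u : PathRow xs y)
    (i : I) : evalLin W (pathShift p u i) = evalPath W p * evalLin W (u i) := by
  change evalMap W _ _ (Finsupp.mapDomain (fun r => r.comp p) (u i)) = _
  rw [evalMap, Finsupp.linearCombination_mapDomain]
  simp [Finsupp.linearCombination_apply, evalLin, Finsupp.sum, Matrix.mul_sum, evalPath_comp]

lemma evalLin_sum_pathShift (W : QRep Q β) {y z : Q.V} (c : PathComb y z) (u : PathRow xs y)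
    (i : I) : evalLin W ((c.sum fun p k => k • pathShift p u) i) =
      evalLin W c * evalLin W (u i) := by
  simp only [Finsupp.sum, Finset.sum_apply, Pi.smul_apply]
  rw [← evalMap_apply, map_sum]
  simp only [map_smul, evalMap_apply, evalLin_pathShift]
  conv_rhs => rw [evalLin, Finsupp.sum, Matrix.sum_mul]
  simp only [Matrix.smul_mul]

lemma pathShift_nil {z : Q.V} (u : PathRow xs z) : pathShift Quiver.Path.nil u = u := by
  funext i
  exact Finsupp.mapDomain_id

lemma pathShift_cons {x y z : Q.V} (p : Quiver.Path x y) (e : y ⟶ z) (u : PathRow xs x) :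
    pathShift (p.cons e) u = pathShift (Quiver.Path.nil.cons e) (pathShift p u) := by
  funext i
  change Finsupp.mapDomain _ (u i) = Finsupp.mapDomain _ (Finsupp.mapDomain _ (u i))
  rw [← Finsupp.mapDomain_comp]
  rfl

lemma relRows_le_comap_pathShift (W : QRep Q β) (f : PathBlock xs ys) {y z : Q.V}
    (p : Quiver.Path y z) : relRows W f y ≤ (relRows W f z).comap (pathShift p) := by
  rintro u ⟨v, hv⟩
  refine ⟨pathShift p v, fun i => ?_⟩
  change evalLin W (pathShift p u i) = _
  have hv' : evalLin W (u i) = _ := hv i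
  rw [evalLin_pathShift, hv', Matrix.mul_sum]
  simp only [evalLin_pathShift, Matrix.mul_assoc]

lemma exists_presented_module [Finite I] (W : QRep Q β) (f : PathBlock xs ys) :
    ∃ (α : Q.V → ℕ) (N : QRep Q α) (Φ : ∀ z, PathRow xs z →ₗ[ℂ] (Fin (α z) → ℂ)),
      (∀ z, Function.Surjective (Φ z)) ∧ (∀ z, LinearMap.ker (Φ z) = relRows W f z) ∧
      ∀ {y z : Q.V} (p : Quiver.Path y z) u, Φ z (pathShift p u) = evalPath N p *ᵥ Φ y u := by
  obtain ⟨N, b, hb⟩ := exists_qRep (Q := Q) (U := fun z => PathRow xs z ⧸ relRows W f z)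
    fun a => (relRows W f (Q.t a)).mapQ (relRows W f (Q.h a))
      (pathShift (Quiver.Path.nil.cons (⟨a, rfl, rfl⟩ : Q.t a ⟶ Q.h a)))
      (relRows_le_comap_pathShift W f _)
  refine ⟨_, N, fun z => (b z).toLinearMap ∘ₗ (relRows W f z).mkQ, fun z => ?_, fun z => ?_, ?_⟩
  · exact (b z).surjective.comp (Submodule.mkQ_surjective _)
  · rw [LinearMap.ker_comp_of_ker_eq_bot _ (LinearEquiv.ker (b z)), Submodule.ker_mkQ]
  · intro y z p u
    induction p with
    | nil => rw [pathShift_nil, evalPath, Matrix.one_mulVec]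
    | cons p e ih =>
      obtain ⟨a, rfl, rfl⟩ := e
      rw [evalPath_cons_mk, ← Matrix.mulVec_mulVec, ← ih, pathShift_cons]
      exact hb a (Submodule.Quotient.mk (pathShift p u))

lemma exists_presented_family [Fintype I] [DecidableEq I] (W : QRep Q β) (f : PathBlock xs ys) :
    ∃ (κ : Type) (_ : Fintype κ) (γ : κ → Q.V → ℕ) (V : ∀ k, QRep Q (γ k))
      (m : ∀ k i, Fin (γ k (xs i)) → ℂ),
      (∀ k, V k ∈ modSet (annRel W) (γ k)) ∧ (∀ k, IsIndecRep (V k)) ∧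
      (∀ z (u : PathRow xs z), (∀ k, rowAct (V k) u (m k) = 0) ↔ u ∈ relRows W f z) ∧
      ∀ z (w : ∀ k, Fin (γ k z) → ℂ), ∃ u : PathRow xs z, ∀ k, rowAct (V k) u (m k) = w k := by
  obtain ⟨α, N, Φ, hΦs, hΦk, hΦ⟩ := exists_presented_module W f
  let e : ∀ i, PathRow xs (xs i) := fun i => Pi.single i (Finsupp.single Quiver.Path.nil 1)
  let m : ∀ i, Fin (α (xs i)) → ℂ := fun i => Φ _ (e i)
  have hlin : ∀ {y z} (c : PathComb y z) (u : PathRow xs y),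
      evalLin N c *ᵥ Φ y u = Φ z (c.sum fun p k => k • pathShift p u) := by
    intro y z c u
    simp only [evalLin_mulVec, Finsupp.sum, map_sum, map_smul, hΦ]
  have hrow : ∀ z (u : PathRow xs z), rowAct N u m = Φ z u := by
    intro z u
    simp only [rowAct, m, hlin]
    rw [← map_sum]
    congr 1
    have h1 : ∀ i (p : Quiver.Path (xs i) z),
        pathShift p (e i) = Pi.single i (Finsupp.single p 1) := by
      intro i p
      funext i'
      change Finsupp.mapDomain _ (e i i') = _
      by_cases h : i' = i
      · subst h
        simp [e]
      · simp [e, h]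
    funext i'
    simp only [h1, Finsupp.sum, Finset.sum_apply, Pi.smul_apply]
    rw [Finset.sum_eq_single i']
    · simpa [Finsupp.sum] using (u i').sum_single
    · intro i _ hi
      simp [Pi.single_eq_of_ne hi.symm]
    · simp
  have hN : N ∈ modSet (annRel W) α := by
    rintro ⟨x, y, c⟩ hr
    apply Matrix.ext_of_mulVec_single
    intro i
    obtain ⟨u, hu⟩ := hΦs _ (Pi.single i 1)
    rw [← hu, hlin, Matrix.zero_mulVec, ← LinearMap.mem_ker, hΦk]
    refine ⟨0, fun i => ?_⟩
    have hr' : evalLin W c = 0 := hr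
    change evalLin W ((c.sum fun p k => k • pathShift p u) i) = _
    rw [evalLin_sum_pathShift, hr']
    simp [← evalMap_apply]
  obtain ⟨κ, _, F, hF, hFi⟩ := exists_decomposition _ N rfl
  have hact : ∀ k z (u : PathRow xs z),
      rowAct (F k).rep u (fun i => (F k).map _ (m i)) = (F k).map z (Φ z u) := by
    intro k z u
    rw [← hrow, rowAct, rowAct, map_sum]
    exact Finset.sum_congr rfl fun i _ =>
      (evalLin_mulVec_intertwine N (F k).rep (F k).map (F k).comm (u i) (m i)).symm
  have hFs : ∀ k z, Function.Surjective ((F k).map z) := by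
    classical
    intro k z w
    obtain ⟨v, hv⟩ := (hF z).2 (Pi.single k w)
    exact ⟨v, by simpa using congrFun hv k⟩
  refine ⟨κ, inferInstance, fun k => (F k).dim, fun k => (F k).rep,
    fun k i => (F k).map _ (m i), fun k => (F k).rep_mem_modSet (hFs k) hN, hFi, ?_, ?_⟩
  · intro z u
    rw [← hΦk, LinearMap.mem_ker]
    simp only [hact]
    refine ⟨fun h => (hF z).1 (funext fun k => ?_), fun h k => by rw [h, map_zero]⟩
    simp [h k]
  · intro z w
    obtain ⟨v, hv⟩ := (hF z).2 w
    obtain ⟨u, rfl⟩ := hΦs z v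
    exact ⟨u, fun k => (hact k z u).trans (congrFun hv k)⟩

end Presentation

section Tameness

/-- The entries of `V` depend on constants in `T` and one parameter `l` only, infinitesimally:
derivations killing `T` act on `V` through their value at `l`. -/
def IsOneParam (T : Set ℂ) {γ : Q.V → ℕ} (V : QRep Q γ) (l : ℂ) (N : C1sp (Q := Q) γ γ) : Prop :=
  ∀ D ∈ derivationsKilling T, ∀ a r c, D (V a r c) = D l * N a r c

lemma derivation_polynomial_eval (D : Derivation ℤ ℂ ℂ) (p : Polynomial ℂ)
    (hp : ∀ n, D (p.coeff n) = 0) (l : ℂ) : D (p.eval l) = D l * p.derivative.eval l := by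
  rw [Polynomial.eval_eq_sum, Polynomial.derivative_eval, Polynomial.sum, Polynomial.sum, map_sum,
    Finset.mul_sum]
  refine Finset.sum_congr rfl fun n _ => ?_
  rw [Derivation.leibniz, hp, Derivation.leibniz_pow]
  simp only [smul_eq_mul, nsmul_eq_mul, mul_zero, add_zero]
  ring

lemma IsTame.exists_countable [Finite Q.A] {S : Set (FormalRel Q)} (hS : IsTame S) :
    ∃ T : Set ℂ, T.Countable ∧ ∀ (α : Q.V → ℕ) (V : QRep Q α), V ∈ modSet S α → IsIndecRep V →
      ∃ (γ : Q.V → ℕ) (V' : QRep Q γ) (l : ℂ) (N : C1sp (Q := Q) γ γ),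
        RIso V' V ∧ IsOneParam T V' l N := by
  choose s γs M hM t βs E hE using hS
  have : Countable Q.A := Finite.to_countable
  let T₁ : Set ℂ := Set.range fun q : (Σ (d : ℕ) (k : Fin (t d)) (a : Q.A),
    Fin (βs d k (Q.h a)) × Fin (βs d k (Q.t a))) => E q.1 q.2.1 q.2.2.1 q.2.2.2.1 q.2.2.2.2
  let T₂ : Set ℂ := Set.range fun q : (Σ (d : ℕ) (i : Fin (s d)) (a : Q.A),
    Fin (γs d i (Q.h a)) × Fin (γs d i (Q.t a)) × ℕ) =>
      (M q.1 q.2.1 q.2.2.1 q.2.2.2.1 q.2.2.2.2.1).coeff q.2.2.2.2.2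
  refine ⟨T₁ ∪ T₂, (Set.countable_range _).union (Set.countable_range _), fun α V hV hVi => ?_⟩
  rcases hE _ α V hV rfl hVi with ⟨k, hk⟩ | ⟨i, l, hk⟩
  · refine ⟨_, _, 0, 0, hk, fun D hD a r c => ?_⟩
    rw [hD _ (Or.inl ⟨⟨_, k, a, r, c⟩, rfl⟩)]
    simp
  · refine ⟨_, _, l, fun a r c => ((M _ i a r c).derivative).eval l, hk, fun D hD a r c => ?_⟩
    exact derivation_polynomial_eval D _ (fun n => hD _ (Or.inr ⟨⟨_, i, a, r, c, n⟩, rfl⟩)) l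

lemma derivation_map_mul (D : Derivation ℤ ℂ ℂ) {l m n : Type} [Fintype m] (A : Matrix l m ℂ)
    (B : Matrix m n ℂ) : (A * B).map D = A.map D * B + A * B.map D := by
  ext i j
  simp only [Matrix.map_apply, Matrix.mul_apply, Matrix.add_apply, map_sum, Derivation.leibniz,
    smul_eq_mul, Finset.sum_add_distrib]
  rw [add_comm]
  simp only [mul_comm]

lemma derivation_comp_mulVec (D : Derivation ℤ ℂ ℂ) {l m : Type} [Fintype m] (A : Matrix l m ℂ)
    (v : m → ℂ) : D ∘ (A *ᵥ v) = A.map D *ᵥ v + A *ᵥ (D ∘ v) := by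
  ext i
  simp only [Function.comp_apply, Matrix.mulVec, dotProduct, Pi.add_apply, Matrix.map_apply,
    map_sum, Derivation.leibniz, smul_eq_mul, Finset.sum_add_distrib]
  rw [add_comm]
  simp only [mul_comm]

lemma IsOneParam.map_evalPath {T : Set ℂ} {γ : Q.V → ℕ} {V : QRep Q γ} {l : ℂ}
    {N : C1sp (Q := Q) γ γ} (h : IsOneParam T V l N) {D : Derivation ℤ ℂ ℂ}
    (hD : D ∈ derivationsKilling T) {x y : Q.V} (p : Quiver.Path x y) :
    (evalPath V p).map D = D l • der V V N p := by
  induction p with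
  | nil =>
    ext i j
    by_cases hij : i = j <;> simp [evalPath, der, hij]
  | cons p e ih =>
    obtain ⟨a, rfl, rfl⟩ := e
    have h1 : (V a).map D = D l • N a := by
      ext r c
      exact h D hD a r c
    rw [evalPath_cons_mk, derivation_map_mul, ih, h1]
    simp [der, castM]

variable {I J : Type} {xs : I → Q.V} {ys : J → Q.V}

/-- The block matrix with prescribed coefficients on finitely many paths. -/
def pathBlockOf (P : ∀ j i, Finset (Quiver.Path (xs i) (ys j))) (c : (Σ j i, P j i) → ℂ) :
    PathBlock xs ys :=
  fun j i => ∑ p : P j i, Finsupp.single p.1 (c ⟨j, i, p⟩)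

lemma evalLin_pathBlockOf (P : ∀ j i, Finset (Quiver.Path (xs i) (ys j)))
    (c : (Σ j i, P j i) → ℂ) {γ : Q.V → ℕ} (V : QRep Q γ) (j i) :
    evalLin V (pathBlockOf P c j i) = ∑ p : P j i, c ⟨j, i, p⟩ • evalPath V p.1 := by
  rw [← evalMap_apply, pathBlockOf, map_sum]
  simp only [evalMap_apply, evalLin_single]

lemma IsOneParam.derivation_comp_rowAct [Fintype I] {T : Set ℂ} {γ : Q.V → ℕ} {V : QRep Q γ} {l : ℂ}
    {N : C1sp (Q := Q) γ γ} (h : IsOneParam T V l N) {D : Derivation ℤ ℂ ℂ}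
    (hD : D ∈ derivationsKilling T) (P : ∀ j i, Finset (Quiver.Path (xs i) (ys j)))
    (z : (Σ j i, P j i) → ℂ) (m : ∀ i, Fin (γ (xs i)) → ℂ) (j : J) :
    D ∘ rowAct V (pathBlockOf P z j) m = rowAct V (pathBlockOf P (D ∘ z) j) m +
      D l • (∑ i, (∑ p : P j i, z ⟨j, i, p⟩ • der V V N p.1) *ᵥ m i) +
      rowAct V (pathBlockOf P z j) (fun i => D ∘ m i) := by
  have h1 : ∀ i, (evalLin V (pathBlockOf P z j i)).map D =
      evalLin V (pathBlockOf P (D ∘ z) j i) +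
        D l • ∑ p : P j i, z ⟨j, i, p⟩ • der V V N p.1 := by
    intro i
    rw [evalLin_pathBlockOf, evalLin_pathBlockOf, Finset.smul_sum, ← Finset.sum_add_distrib]
    ext r c
    simp only [Matrix.map_apply, Matrix.sum_apply, map_sum, Matrix.add_apply, Matrix.smul_apply,
      Derivation.leibniz, smul_eq_mul, Function.comp_apply]
    refine Finset.sum_congr rfl fun p _ => ?_
    have h2 := congrFun (congrFun (h.map_evalPath hD p.1) r) c
    simp only [Matrix.map_apply, Matrix.smul_apply, smul_eq_mul] at h2
    rw [h2]
    ring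
  have h3 : D ∘ rowAct V (pathBlockOf P z j) m =
      ∑ i, D ∘ (evalLin V (pathBlockOf P z j i) *ᵥ m i) := by
    ext r
    simp [rowAct]
  rw [h3, rowAct, rowAct, Finset.smul_sum, ← Finset.sum_add_distrib, ← Finset.sum_add_distrib]
  refine Finset.sum_congr rfl fun i _ => ?_
  rw [derivation_comp_mulVec, h1, Matrix.add_mulVec, Matrix.smul_mulVec]

end Tameness

section WildPencils

variable {I J : Type} {xs : I → Q.V} {ys : J → Q.V} {β : Q.V → ℕ}

lemma exists_spanning_paths (W : QRep Q β) (xs : I → Q.V) (ys : J → Q.V) :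
    ∃ P : ∀ j i, Finset (Quiver.Path (xs i) (ys j)), ∀ h : PathBlock xs ys,
      ∃ c : (Σ j i, P j i) → ℂ, ∀ j i, evalLin W (h j i) = evalLin W (pathBlockOf P c j i) := by
  classical
  have hP : ∀ x y : Q.V, ∃ P : Finset (Quiver.Path x y), ∀ h : PathComb x y,
      ∃ c : P → ℂ, ∑ p : P, c p • evalPath W p.1 = evalLin W h := by
    intro x y
    obtain ⟨κ, a, -, hspan, hli⟩ := exists_linearIndependent' ℂ
      (fun p : Quiver.Path x y => evalPath W p)
    have : Finite κ := hli.finite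
    have := Fintype.ofFinite κ
    refine ⟨Finset.univ.image a, fun h => ?_⟩
    have hmem : evalLin W h ∈ Submodule.span ℂ (Set.range fun p => evalPath W p) := by
      rw [← evalMap_apply, evalMap, ← Finsupp.range_linearCombination]
      exact ⟨h, rfl⟩
    rw [← Submodule.mem_span_range_iff_exists_fun]
    refine Submodule.span_mono ?_ (hspan ▸ hmem)
    rintro _ ⟨k, rfl⟩
    exact ⟨⟨a k, by simp⟩, rfl⟩
  choose P hP using hP
  refine ⟨fun j i => P (xs i) (ys j), fun h => ?_⟩
  choose c hc using fun j i => hP (xs i) (ys j) (h j i)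
  exact ⟨fun q => c q.1 q.2.1 q.2.2, fun j i => by rw [evalLin_pathBlockOf, hc]⟩

lemma exists_dominating_derivation (T : Set ℂ) {κ : Type} [Finite κ] (l : κ → ℂ) :
    ∃ D₀ ∈ derivationsKilling T, ∀ D ∈ derivationsKilling T, ∃ t : κ → ℂ,
      ∀ k, D (l k) = t k * D₀ (l k) := by
  let ev : κ → Module.Dual ℂ (derivationsKilling T) := fun k =>
    { toFun := fun D => D.1 (l k)
      map_add' := fun _ _ => rfl
      map_smul' := fun _ _ => rfl }
  obtain ⟨D₀, hD₀⟩ := Module.Dual.exists_forall_ne_zero_of_forall_exists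
    (fun k : {k // ∃ D, ev k D ≠ 0} => ev k.1) fun k => k.2
  refine ⟨D₀.1, D₀.2, fun D hD => ⟨fun k => D (l k) / D₀.1 (l k), fun k => ?_⟩⟩
  by_cases hk : ∃ D, ev k D ≠ 0
  · exact (div_mul_cancel₀ _ (hD₀ ⟨k, hk⟩)).symm
  · push Not at hk
    have h1 : D (l k) = 0 := hk ⟨D, hD⟩
    have h2 : D₀.1 (l k) = 0 := hk D₀
    rw [h1, h2, mul_zero]

lemma exists_blk_mul_of_mem_relRows [Fintype J] (W : QRep Q β) (f u : PathBlock xs ys)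
    (hu : ∀ j, u j ∈ relRows W f (ys j)) :
    ∃ a : PathBlock ys ys, blk W u = blk W a * blk W f := by
  choose v hv using hu
  refine ⟨v, ?_⟩
  ext r c
  rw [Matrix.mul_apply, Fintype.sum_sigma, blk_apply]
  have := congrFun (congrFun (hv r.1 c.1) r.2) c.2
  simp only [Matrix.sum_apply, Matrix.mul_apply] at this
  exact this

lemma mem_relRows_of_blk_eq [Fintype J] (W : QRep Q β) {f u : PathBlock xs ys}
    {a : PathBlock ys ys} (h : blk W u = blk W a * blk W f) (j : J) :
    u j ∈ relRows W f (ys j) := by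
  refine ⟨a j, fun i => ?_⟩
  change evalLin W (u j i) = _
  ext r c
  have := congrFun (congrFun h ⟨j, r⟩) ⟨i, c⟩
  rw [Matrix.mul_apply, Fintype.sum_sigma, blk_apply] at this
  simp only [Matrix.sum_apply, Matrix.mul_apply]
  exact this

variable [Fintype I]

lemma rowAct_intertwine {α γ : Q.V → ℕ} (N : QRep Q α) (V : QRep Q γ)
    (p : ∀ z, (Fin (α z) → ℂ) →ₗ[ℂ] (Fin (γ z) → ℂ))
    (hp : ∀ a v, p (Q.h a) (N a *ᵥ v) = V a *ᵥ p (Q.t a) v) {z : Q.V}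
    (u : PathRow xs z) (m : ∀ i, Fin (α (xs i)) → ℂ) :
    p z (rowAct N u m) = rowAct V u fun i => p _ (m i) := by
  simp only [rowAct, map_sum, evalLin_mulVec_intertwine N V p hp]

lemma rowAct_sub_left {γ : Q.V → ℕ} (V : QRep Q γ) {z : Q.V} (u v : PathRow xs z)
    (m : ∀ i, Fin (γ (xs i)) → ℂ) : rowAct V (u - v) m = rowAct V u m - rowAct V v m := by
  simp only [rowAct, Pi.sub_apply, ← evalMap_apply, map_sub, Matrix.sub_mulVec,
    Finset.sum_sub_distrib]

lemma rowAct_sub {γ : Q.V → ℕ} (V : QRep Q γ) {z : Q.V} (u : PathRow xs z)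
    (m m' : ∀ i, Fin (γ (xs i)) → ℂ) :
    rowAct V u (m - m') = rowAct V u m - rowAct V u m' := by
  simp only [rowAct, Pi.sub_apply, Matrix.mulVec_sub, Finset.sum_sub_distrib]

lemma rowAct_smul {γ : Q.V → ℕ} (V : QRep Q γ) {z : Q.V} (t : ℂ) (u : PathRow xs z)
    (m : ∀ i, Fin (γ (xs i)) → ℂ) : rowAct V u (t • m) = t • rowAct V u m := by
  simp only [rowAct, Pi.smul_apply, Matrix.mulVec_smul, Finset.smul_sum]

lemma rowAct_blkMul [Fintype J] {K : Type} {zs : K → Q.V} {γ : Q.V → ℕ} (V : QRep Q γ)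
    (a : PathBlock ys zs) (f : PathBlock xs ys) (k : K) (m : ∀ i, Fin (γ (xs i)) → ℂ) :
    rowAct V (blkMul a f k) m = rowAct V (a k) fun j => rowAct V (f j) m := by
  simp only [rowAct, blkMul, ← evalMap_apply, map_sum, Matrix.sum_mulVec, Matrix.mulVec_sum]
  rw [Finset.sum_comm]
  simp only [evalMap_apply, evalLin_pathMul, Matrix.mulVec_mulVec]

/-- A block matrix with generic coefficients is presented by modules on which every derivation
acts through one parameter per module. -/
lemma exists_oneParam_family [Fintype J] [DecidableEq I] (W : QRep Q β) {T : Set ℂ}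
    (hT : ∀ (α : Q.V → ℕ) (V : QRep Q α), V ∈ modSet (annRel W) α → IsIndecRep V →
      ∃ (γ : Q.V → ℕ) (V' : QRep Q γ) (l : ℂ) (N : C1sp (Q := Q) γ γ),
        RIso V' V ∧ IsOneParam T V' l N) (f : PathBlock xs ys) :
    ∃ (κ : Type) (_ : Fintype κ) (γ : κ → Q.V → ℕ) (V : ∀ k, QRep Q (γ k))
      (m : ∀ k i, Fin (γ k (xs i)) → ℂ) (l : κ → ℂ) (N : ∀ k, C1sp (Q := Q) (γ k) (γ k)),
      (∀ k, IsOneParam T (V k) (l k) (N k)) ∧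
      (∀ z (u : PathRow xs z), (∀ k, rowAct (V k) u (m k) = 0) ↔ u ∈ relRows W f z) ∧
      ∀ z (w : ∀ k, Fin (γ k z) → ℂ), ∃ u : PathRow xs z, ∀ k, rowAct (V k) u (m k) = w k := by
  obtain ⟨κ, hκ, α, V, m, hV, hVi, hker, hsurj⟩ := exists_presented_family W f
  choose γ V' l N hiso hone using fun k => hT (α k) (V k) (hV k) (hVi k)
  choose e he using hiso
  have hsymm : ∀ k z (u : PathRow xs z), rowAct (V' k) u (fun i => (e k _).symm (m k i)) =
      (e k z).symm (rowAct (V k) u (m k)) := by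
    intro k z u
    rw [LinearEquiv.eq_symm_apply]
    have := rowAct_intertwine (V' k) (V k) (fun z => (e k z).toLinearMap)
      (fun a v => LinearMap.congr_fun (he k a) v) u (fun i => (e k _).symm (m k i))
    simpa using this
  refine ⟨κ, hκ, γ, V', fun k i => (e k _).symm (m k i), l, N, hone, fun z u => ?_,
    fun z w => ?_⟩
  · simp only [hsymm, LinearEquiv.map_eq_zero_iff, hker]
  · obtain ⟨u, hu⟩ := hsurj z fun k => e k z (w k)
    exact ⟨u, fun k => by rw [hsymm, hu, LinearEquiv.symm_apply_apply]⟩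

/-- Over a tame algebra, the tangent space of the orbit of a generic block matrix has codimension
at most one, in the following form. -/
lemma exists_generic_pencil [Finite Q.A] [Fintype J] [DecidableEq I] [DecidableEq J]
    (W : QRep Q β) (htame : IsTame (annRel W)) :
    ∃ f h₀ : PathBlock xs ys, ∀ h : PathBlock xs ys,
      ∃ (a a' : PathBlock ys ys) (b b' : PathBlock xs xs),
        blk W h = blk W h₀ * blk W b + blk W f * blk W b' + blk W a * blk W f ∧
        blk W f * blk W b = blk W a' * blk W f := by
  obtain ⟨T, hTc, hT⟩ := htame.exists_countable
  obtain ⟨P, hP⟩ := exists_spanning_paths W xs ys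
  obtain ⟨z, hz⟩ := exists_generic_point hTc (Σ j i, P j i)
  set f := pathBlockOf P z with hf
  obtain ⟨κ, hκ, γ, V, m, l, N, hone, hker, hsurj⟩ := exists_oneParam_family W hT f
  obtain ⟨D₀, hD₀, hdom⟩ := exists_dominating_derivation T l
  have hfm : ∀ k j, rowAct (V k) (f j) (m k) = 0 := fun k j =>
    (hker _ _).2 (mem_relRows_of_blk_eq W (a := blkOne ys)
      (by rw [blk_blkOne, Matrix.one_mul]) j) k
  refine ⟨f, pathBlockOf P (D₀ ∘ z), fun h => ?_⟩
  obtain ⟨c, hc⟩ := hP h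
  obtain ⟨D, hD, hDz⟩ := hz c
  obtain rfl : c = D ∘ z := funext fun q => (hDz q).symm
  obtain ⟨t, ht⟩ := hdom D hD
  choose b hb using fun i => hsurj (xs i) fun k => t k • m k i
  choose b' hb' using fun i => hsurj (xs i) fun k =>
    t k • (D₀ ∘ m k i : _ → ℂ) - (D ∘ m k i : _ → ℂ)
  have hbh : blk W h = blk W (pathBlockOf P (D ∘ z)) := by
    ext r c
    rw [blk_apply, hc, blk_apply]
  have hderiv : ∀ k j, rowAct (V k) (pathBlockOf P (D ∘ z) j) (m k) =
      t k • rowAct (V k) (pathBlockOf P (D₀ ∘ z) j) (m k) +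
        rowAct (V k) (f j) (fun i => t k • (D₀ ∘ m k i : _ → ℂ) - (D ∘ m k i : _ → ℂ)) := by
    intro k j
    have h1 := (hone k).derivation_comp_rowAct hD P z (m k) j
    have h2 := (hone k).derivation_comp_rowAct hD₀ P z (m k) j
    rw [← hf, hfm] at h1 h2
    have h3 : ∀ D : Derivation ℤ ℂ ℂ, (D ∘ (0 : Fin (γ k (ys j)) → ℂ)) = 0 := fun D => by
      ext; simp
    rw [h3] at h1 h2
    rw [ht, mul_smul] at h1
    have h4 := rowAct_sub (V k) (f j) (t k • fun i => (D₀ ∘ m k i : _ → ℂ)) (fun i => D ∘ m k i)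
    rw [rowAct_smul] at h4
    have h5 : rowAct (V k) (f j) (fun i => t k • (D₀ ∘ m k i : _ → ℂ) - (D ∘ m k i : _ → ℂ)) = _ :=
      h4
    rw [h5]
    linear_combination (norm := module) (t k) • h2 - h1
  obtain ⟨a, ha⟩ := exists_blk_mul_of_mem_relRows W f
    (pathBlockOf P (D ∘ z) - blkMul (pathBlockOf P (D₀ ∘ z)) b - blkMul f b') fun j => by
      rw [← hker]
      intro k
      change rowAct (V k) (pathBlockOf P (D ∘ z) j - blkMul (pathBlockOf P (D₀ ∘ z)) b j
        - blkMul f b' j) (m k) = 0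
      rw [rowAct_sub_left, rowAct_sub_left, rowAct_blkMul, rowAct_blkMul, hderiv]
      simp only [hb, hb']
      have := rowAct_smul (V k) (t k) (pathBlockOf P (D₀ ∘ z) j) (m k)
      rw [← this]
      exact (congrArg₂ _ (add_sub_cancel_left _ _) rfl).trans (sub_self _)
  obtain ⟨a', ha'⟩ := exists_blk_mul_of_mem_relRows W f (blkMul f b) fun j => by
    rw [← hker]
    intro k
    rw [rowAct_blkMul]
    simp only [hb]
    exact (rowAct_smul (V k) (t k) (f j) (m k)).trans (by rw [hfm, smul_zero])
  refine ⟨a, a', b, b', ?_, ?_⟩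
  · rw [map_sub, map_sub, blk_blkMul, blk_blkMul] at ha
    rw [hbh, ← ha]
    abel
  · rw [← blk_blkMul, ha']

/-- Over a tame algebra, some pair of block matrices `f`, `f'` generates all block matrices by
left multiplication of `f` and right multiplication of `f'`. -/
theorem exists_generating_pair [Finite Q.A] [Fintype J] (W : QRep Q β)
    (htame : IsTame (annRel W)) (xs : I → Q.V) (ys : J → Q.V) :
    ∃ f f' : PathBlock xs ys, ∀ h : PathBlock xs ys,
      ∃ (a : PathBlock ys ys) (b : PathBlock xs xs),
        blk W h = blk W a * blk W f + blk W f' * blk W b := by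
  classical
  obtain ⟨f, h₀, hfh⟩ := exists_generic_pencil (xs := xs) (ys := ys) W htame
  let Λ : ℂ → (PathBlock ys ys × PathBlock xs xs →ₗ[ℂ] _) := fun ε =>
    (mulRightLinearMap _ ℂ (blk W f) ∘ₗ blk W).coprod
      (mulLeftLinearMap _ ℂ (blk W f + ε • blk W h₀) ∘ₗ blk W)
  let R := LinearMap.range (blk W : PathBlock xs ys →ₗ[ℂ] _)
  obtain ⟨ε, -, hε⟩ := exists_eq_top_of_infinitesimal
    (fun ε => (LinearMap.range (Λ ε)).comap R.subtype) (by
      rintro ⟨_, h, rfl⟩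
      obtain ⟨a, a', b, b', h1, h2⟩ := hfh h
      refine ⟨⟨blk W (blkMul h₀ b'), _, rfl⟩, fun ε hε => ⟨(a - ε⁻¹ • a', b' + ε⁻¹ • b), ?_⟩⟩
      simp only [Λ, LinearMap.coprod_apply, LinearMap.comp_apply, mulRightLinearMap_apply,
        mulLeftLinearMap_apply, Submodule.subtype_apply, map_sub, map_add, map_smul, blk_blkMul, h1,
        Matrix.add_mul, Matrix.smul_mul, smul_add, smul_smul, h2, inv_mul_cancel₀ hε, one_smul]
      abel)
  refine ⟨f, f + ε • h₀, fun h => ?_⟩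
  have hmem : (⟨blk W h, h, rfl⟩ : R) ∈ (LinearMap.range (Λ ε)).comap R.subtype :=
    hε ▸ Submodule.mem_top
  obtain ⟨⟨a, b⟩, hab⟩ := hmem
  refine ⟨a, b, ?_⟩
  rw [map_add, map_smul]
  exact hab.symm

end WildPencils

section King

lemma prod_zpow_eq_zpow_sum {ι : Type} (s : Finset ι) {t : ℂ} (ht : t ≠ 0) (n : ι → ℤ) :
    ∏ x ∈ s, t ^ n x = t ^ ∑ x ∈ s, n x := by
  classical
  induction s using Finset.induction_on with
  | empty => simp
  | insert x s hx ih => rw [Finset.prod_insert hx, Finset.sum_insert hx, zpow_add₀ ht, ih]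

lemma exists_projection_matrix {n : ℕ} (U : Submodule ℂ (Fin n → ℂ)) :
    ∃ P : Matrix (Fin n) (Fin n) ℂ, (∀ v, P *ᵥ v ∈ U) ∧ ∀ v ∈ U, P *ᵥ v = v := by
  obtain ⟨g, hg⟩ := LinearMap.exists_leftInverse_of_injective U.subtype (Submodule.ker_subtype U)
  refine ⟨LinearMap.toMatrix' (U.subtype ∘ₗ g), fun v => ?_, fun v hv => ?_⟩
  · rw [LinearMap.toMatrix'_mulVec]
    exact (g v).2
  · rw [LinearMap.toMatrix'_mulVec]
    exact congrArg Subtype.val (LinearMap.congr_fun hg ⟨v, hv⟩)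

lemma det_one_add_smul_projection {n : ℕ} {U : Submodule ℂ (Fin n → ℂ)}
    {P : Matrix (Fin n) (Fin n) ℂ} (hP : ∀ v, P *ᵥ v ∈ U) (hPU : ∀ v ∈ U, P *ᵥ v = v) (t : ℂ) :
    (1 + (t - 1) • P).det = t ^ Module.finrank ℂ U := by
  have happ : ∀ v, toLin' (1 + (t - 1) • P) v = v + (t - 1) • (P *ᵥ v) := fun v => by
    rw [toLin'_apply, Matrix.add_mulVec, Matrix.one_mulVec, Matrix.smul_mulVec]
  have hU : U ≤ U.comap (toLin' (1 + (t - 1) • P)) := fun v hv => by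
    rw [Submodule.mem_comap, happ]
    exact U.add_mem hv (U.smul_mem _ (hP v))
  have hres : (toLin' (1 + (t - 1) • P)).restrict hU = t • LinearMap.id := by
    ext1 v
    apply Subtype.ext
    change toLin' (1 + (t - 1) • P) v = t • (v : Fin n → ℂ)
    rw [happ, hPU _ v.2]
    module
  have hquot : U.mapQ U (toLin' (1 + (t - 1) • P)) hU = LinearMap.id := by
    refine Submodule.linearMap_qext _ (LinearMap.ext fun v => ?_)
    change Submodule.Quotient.mk (toLin' (1 + (t - 1) • P) v) = Submodule.Quotient.mk v
    rw [Submodule.Quotient.eq, happ, add_sub_cancel_left]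
    exact U.smul_mem _ (hP v)
  rw [← LinearMap.det_toLin', LinearMap.det_eq_det_mul_det U _ hU, hres, hquot, LinearMap.det_smul,
    LinearMap.det_id, LinearMap.det_id, mul_one, mul_one]

/-- The invertible matrix scaling the range of an idempotent by `t`. -/
def scaleUnit {n : ℕ} {P : Matrix (Fin n) (Fin n) ℂ} (hP : P * P = P) {t : ℂ} (ht : t ≠ 0) :
    GL (Fin n) ℂ where
  val := 1 + (t - 1) • P
  inv := 1 + (t⁻¹ - 1) • P
  val_inv := by
    simp only [Matrix.add_mul, Matrix.mul_add, Matrix.one_mul, Matrix.mul_one, Matrix.smul_mul,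
      Matrix.mul_smul, hP]
    match_scalars <;> field_simp; ring
  inv_val := by
    simp only [Matrix.add_mul, Matrix.mul_add, Matrix.one_mul, Matrix.mul_one, Matrix.smul_mul,
      Matrix.mul_smul, hP]
    match_scalars <;> field_simp; ring

variable {β : Q.V → ℕ}

lemma SubRep.exists_degeneration {W : QRep Q β} {U : ∀ x, Submodule ℂ (Fin (β x) → ℂ)}
    (hU : SubRep W U) : ∃ A B : QRep Q β, ∀ t : ℂ, t ≠ 0 → ∃ g : GLb β,
      (∀ τ, chi τ g = t ^ ∑ x, τ x * (Module.finrank ℂ (U x) : ℤ)) ∧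
      gAct g W = fun a => (A a + t • B a : Matrix _ _ ℂ) := by
  choose P hP hPU using fun x => exists_projection_matrix (U x)
  have hPP : ∀ x, P x * P x = P x := fun x => by
    apply Matrix.ext_of_mulVec_single
    intro i
    rw [← Matrix.mulVec_mulVec, hPU x _ (hP x _)]
  have hPW : ∀ a, P (Q.h a) * (W a * P (Q.t a)) = W a * P (Q.t a) := fun a => by
    apply Matrix.ext_of_mulVec_single
    intro i
    rw [← Matrix.mulVec_mulVec, ← Matrix.mulVec_mulVec, hPU]
    exact hU a ⟨_, hP _ _, rfl⟩
  refine ⟨fun a => (W a - P (Q.h a) * W a + W a * P (Q.t a) : Matrix _ _ ℂ),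
    fun a => (P (Q.h a) * W a - W a * P (Q.t a) : Matrix _ _ ℂ), fun t ht =>
    ⟨fun x => scaleUnit (hPP x) ht, fun τ => ?_, ?_⟩⟩
  · rw [chi, ← prod_zpow_eq_zpow_sum _ ht]
    refine Finset.prod_congr rfl fun x _ => ?_
    change (1 + (t - 1) • P x).det ^ τ x = _
    rw [det_one_add_smul_projection (hP x) (hPU x), mul_comm, _root_.zpow_mul, zpow_natCast]
  · funext a
    change (1 + (t - 1) • P (Q.h a)) * W a * (1 + (t⁻¹ - 1) • P (Q.t a)) = _
    simp only [Matrix.add_mul, Matrix.mul_add, Matrix.one_mul, Matrix.mul_one, Matrix.smul_mul,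
      Matrix.mul_smul, Matrix.mul_assoc, hPW]
    match_scalars <;> field_simp <;> ring

/-- The numerical criterion for semistability, easy direction. -/
lemma IsSemiInvariant.sum_finrank_nonneg {W : QRep Q β} {τ : Q.V → ℤ} {F : QRep Q β → ℂ}
    (hF : IsSemiInvariant τ F) (hFW : F W ≠ 0) {U : ∀ x, Submodule ℂ (Fin (β x) → ℂ)}
    (hU : SubRep W U) : 0 ≤ ∑ x, τ x * (Module.finrank ℂ (U x) : ℤ) := by
  by_contra! hlt
  obtain ⟨A, B, hAB⟩ := hU.exists_degeneration
  obtain ⟨⟨p, hp⟩, hequiv⟩ := hF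
  obtain ⟨m, hm⟩ := Int.eq_ofNat_of_zero_le (neg_nonneg.2 hlt.le)
  have hm0 : m ≠ 0 := by omega
  let φ : ℂ → ℂ := fun t =>
    t ^ m * MvPolynomial.eval (repCoords (β := β) fun a => (A a + t • B a : Matrix _ _ ℂ)) p
  have hcont : Continuous φ := by
    refine (continuous_pow m).mul (p.continuous_eval.comp ?_)
    refine continuous_pi fun c => ?_
    change Continuous fun t : ℂ => A c.1 c.2.1 c.2.2 + t * B c.1 c.2.1 c.2.2
    fun_prop
  have hφ : ∀ t, t ≠ 0 → φ t = F W := by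
    intro t ht
    obtain ⟨g, hg, hgW⟩ := hAB t ht
    have h1 := hequiv g W
    rw [hgW, hg] at h1
    change t ^ m * MvPolynomial.eval _ _ = _
    rw [(hp _).symm.trans h1, ← mul_assoc, ← zpow_natCast, ← zpow_add₀ ht,
      show (m : ℤ) = -_ from hm.symm, neg_add_cancel, zpow_zero, one_mul]
  have h0 : φ 0 = 0 := by
    change (0 : ℂ) ^ m * _ = 0
    rw [zero_pow hm0, zero_mul]
  have hlim : Filter.Tendsto φ (nhdsWithin 0 {0}ᶜ) (nhds (F W)) :=
    tendsto_const_nhds.congr' (eventually_nhdsWithin_of_forall fun t ht => (hφ t ht).symm)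
  have := tendsto_nhds_unique hlim (hcont.continuousAt.tendsto.mono_left nhdsWithin_le_nhds)
  exact hFW (this.trans h0)

lemma IsSemiInvariant.sum_eq_zero {W : QRep Q β} {τ : Q.V → ℤ} {F : QRep Q β → ℂ}
    (hF : IsSemiInvariant τ F) (hFW : F W ≠ 0) : ∑ x, τ x * (β x : ℤ) = 0 := by
  let g : GLb β := fun x => scaleUnit (Matrix.one_mul (1 : Matrix (Fin (β x)) (Fin (β x)) ℂ))
    (two_ne_zero (α := ℂ))
  have hg : gAct g W = W := by
    funext a
    change (1 + ((2 : ℂ) - 1) • 1) * W a * (1 + ((2 : ℂ)⁻¹ - 1) • 1) = _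
    simp only [Matrix.add_mul, Matrix.mul_add, Matrix.one_mul, Matrix.mul_one, Matrix.smul_mul,
      Matrix.mul_smul]
    match_scalars
    norm_num
  have hchi : chi τ g = 2 ^ ∑ x, τ x * (β x : ℤ) := by
    rw [chi, ← prod_zpow_eq_zpow_sum _ two_ne_zero]
    refine Finset.prod_congr rfl fun x _ => ?_
    change (1 + ((2 : ℂ) - 1) • (1 : Matrix (Fin (β x)) (Fin (β x)) ℂ)).det ^ τ x = _
    rw [det_one_add_smul_projection (U := ⊤) (fun _ => trivial) (fun v _ => Matrix.one_mulVec v),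
      finrank_top, Module.finrank_fin_fun, mul_comm, _root_.zpow_mul, zpow_natCast]
  have h1 := hF.2 g W
  rw [hg, hchi] at h1
  have h2 : (2 : ℂ) ^ (∑ x, τ x * (β x : ℤ)) = 1 := mul_right_cancel₀ hFW (by rw [one_mul, ← h1])
  have h3 : (2 : ℝ) ^ (∑ x, τ x * (β x : ℤ)) = 1 := by
    simpa using congrArg norm h2
  exact (zpow_eq_one_iff_right₀ zero_le_two (by norm_num)).1 h3

end King

section Surjectivity

variable {I J : Type} {xs : I → Q.V} {ys : J → Q.V} {β : Q.V → ℕ}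

lemma SubRep.evalLin_mem {W : QRep Q β} {U : ∀ x, Submodule ℂ (Fin (β x) → ℂ)}
    (hU : SubRep W U) {x y : Q.V} (c : PathComb x y) {v : Fin (β x) → ℂ} (hv : v ∈ U x) :
    evalLin W c *ᵥ v ∈ U y := by
  have hpath : ∀ {y : Q.V} (p : Quiver.Path x y), evalPath W p *ᵥ v ∈ U y := by
    intro y p
    induction p with
    | nil => simpa [evalPath] using hv
    | cons p e ih =>
      obtain ⟨a, rfl, rfl⟩ := e
      rw [evalPath_cons_mk, ← Matrix.mulVec_mulVec]
      exact hU a ⟨_, ih, rfl⟩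
  rw [evalLin_mulVec]
  exact Submodule.sum_mem _ fun p _ => Submodule.smul_mem _ _ (hpath p)

/-- The subspace of block vectors all of whose components lie in the given subspaces. -/
def blockSub (U : ∀ x, Submodule ℂ (Fin (β x) → ℂ)) (xs : I → Q.V) :
    Submodule ℂ ((Σ i, Fin (β (xs i))) → ℂ) where
  carrier := {w | ∀ i, (fun c => w ⟨i, c⟩) ∈ U (xs i)}
  add_mem' h h' i := (U (xs i)).add_mem (h i) (h' i)
  zero_mem' i := (U (xs i)).zero_mem
  smul_mem' k _ h i := (U (xs i)).smul_mem k (h i)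

lemma blockSub_mono {U U' : ∀ x, Submodule ℂ (Fin (β x) → ℂ)} (h : U ≤ U') (xs : I → Q.V) :
    blockSub U xs ≤ blockSub U' xs :=
  fun _ hw i => h _ (hw i)

lemma finrank_blockSub [Fintype I] (U : ∀ x, Submodule ℂ (Fin (β x) → ℂ)) (xs : I → Q.V) :
    Module.finrank ℂ (blockSub U xs) = ∑ i, Module.finrank ℂ (U (xs i)) := by
  rw [← Module.finrank_pi_fintype]
  exact LinearEquiv.finrank_eq
    { toFun := fun w i => ⟨fun c => w.1 ⟨i, c⟩, w.2 i⟩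
      invFun := fun v => ⟨fun q => (v q.1).1 q.2, fun i => (v i).2⟩
      map_add' := fun _ _ => rfl
      map_smul' := fun _ _ => rfl
      left_inv := fun _ => rfl
      right_inv := fun _ => rfl }

variable [Fintype I]

lemma blk_mulVec (W : QRep Q β) (h : PathBlock xs ys) (w : (Σ i, Fin (β (xs i))) → ℂ) (j : J) :
    (fun r => (blk W h *ᵥ w) ⟨j, r⟩) = rowAct W (h j) fun i c => w ⟨i, c⟩ := by
  ext r
  simp only [Matrix.mulVec, dotProduct, Fintype.sum_sigma, rowAct, Finset.sum_apply]
  rfl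

lemma SubRep.map_blk_le {W : QRep Q β} {U : ∀ x, Submodule ℂ (Fin (β x) → ℂ)}
    (hU : SubRep W U) (h : PathBlock xs ys) :
    (blockSub U xs).map (blk W h).mulVecLin ≤ blockSub U ys := by
  rintro _ ⟨w, hw, rfl⟩ j
  rw [Matrix.mulVecLin_apply, blk_mulVec]
  exact Submodule.sum_mem _ fun i _ => hU.evalLin_mem _ (hw i)

/-- The subrepresentation generated by the components of a space of block vectors. -/
def genSub (W : QRep Q β) (K : Submodule ℂ ((Σ i, Fin (β (xs i))) → ℂ)) (z : Q.V) :
    Submodule ℂ (Fin (β z) → ℂ) :=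
  Submodule.span ℂ {v | ∃ w ∈ K, ∃ u : PathRow xs z, v = rowAct W u fun i c => w ⟨i, c⟩}

lemma subRep_genSub (W : QRep Q β) (K : Submodule ℂ ((Σ i, Fin (β (xs i))) → ℂ)) :
    SubRep W (genSub W K) := by
  intro a
  rw [genSub, Submodule.map_span, Submodule.span_le]
  rintro _ ⟨_, ⟨w, hw, u, rfl⟩, rfl⟩
  refine Submodule.subset_span
    ⟨w, hw, pathShift (Quiver.Path.nil.cons (⟨a, rfl, rfl⟩ : Q.t a ⟶ Q.h a)) u, ?_⟩
  simp only [rowAct, Matrix.mulVecLin_apply, Matrix.mulVec_sum, Matrix.mulVec_mulVec,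
    evalLin_pathShift, evalPath_cons_mk, evalPath, Matrix.mul_one]

lemma SubRep.sup {W : QRep Q β} {U U' : ∀ x, Submodule ℂ (Fin (β x) → ℂ)}
    (hU : SubRep W U) (hU' : SubRep W U') : SubRep W fun x => U x ⊔ U' x := by
  intro a
  rw [Submodule.map_sup]
  exact sup_le_sup (hU a) (hU' a)

lemma le_blockSub_genSub (W : QRep Q β) (K : Submodule ℂ ((Σ i, Fin (β (xs i))) → ℂ)) :
    K ≤ blockSub (genSub W K) xs := by
  classical
  intro w hw i
  refine Submodule.subset_span ⟨w, hw, blkOne xs i, ?_⟩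
  rw [← blk_mulVec, blk_blkOne, Matrix.one_mulVec]

/-- `f` and `f'` generate all block matrices by left and right multiplication respectively. -/
def IsGeneratingPair [Fintype J] (W : QRep Q β) (f f' : PathBlock xs ys) : Prop :=
  ∀ h : PathBlock xs ys, ∃ (a : PathBlock ys ys) (b : PathBlock xs xs),
    blk W h = blk W a * blk W f + blk W f' * blk W b

lemma IsGeneratingPair.blockSub_le [Fintype J] {W : QRep Q β} {f f' : PathBlock xs ys}
    (hff' : IsGeneratingPair W f f') {U : ∀ x, Submodule ℂ (Fin (β x) → ℂ)} (hU : SubRep W U) :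
    let K := (blockSub U ys).comap (blk W f).mulVecLin
    blockSub (fun x => U x ⊔ genSub W K x) ys ≤
      blockSub U ys ⊔ (blockSub (fun x => U x ⊔ genSub W K x) xs).map (blk W f').mulVecLin := by
  classical
  intro K
  set Z := blockSub U ys ⊔
    (blockSub (fun x => U x ⊔ genSub W K x) xs).map (blk W f').mulVecLin
  let ι : ∀ j, (Fin (β (ys j)) → ℂ) →ₗ[ℂ] ((Σ j, Fin (β (ys j))) → ℂ) := fun j =>
    (LinearEquiv.piCurry ℂ fun j (_ : Fin (β (ys j))) => ℂ).symm.toLinearMap ∘ₗ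
      LinearMap.single ℂ (fun j => Fin (β (ys j)) → ℂ) j
  have hι : ∀ j v j', (fun c => ι j v ⟨j', c⟩) =
      (Pi.single j v : ∀ j, Fin (β (ys j)) → ℂ) j' := fun j v j' => rfl
  have hle : ∀ j, U (ys j) ⊔ genSub W K (ys j) ≤ Z.comap (ι j) := by
    intro j
    refine sup_le (fun v hv => ?_) (Submodule.span_le.2 ?_)
    · refine Submodule.mem_sup_left fun j' => ?_
      rw [hι]
      by_cases hj : j' = j
      · subst hj
        rwa [Pi.single_eq_same]
      · rw [Pi.single_eq_of_ne hj]
        exact Submodule.zero_mem _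
    · rintro _ ⟨w, hw, u, rfl⟩
      let h : PathBlock xs ys := Pi.single j u
      obtain ⟨a, b, hab⟩ := hff' h
      have hιh : ι j (rowAct W u fun i c => w ⟨i, c⟩) = blk W h *ᵥ w := by
        ext ⟨j', c⟩
        refine (congrFun (hι j _ j') c).trans ((congrFun (blk_mulVec W h w j') c).trans ?_).symm
        by_cases hj : j' = j
        · subst hj
          rw [Pi.single_eq_same, show h j' = u from Pi.single_eq_same _ _]
        · rw [Pi.single_eq_of_ne hj, show h j' = 0 from Pi.single_eq_of_ne hj _]
          simp [rowAct, ← evalMap_apply]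
      change ι j _ ∈ Z
      rw [hιh, hab, Matrix.add_mulVec, ← Matrix.mulVec_mulVec, ← Matrix.mulVec_mulVec]
      refine Submodule.add_mem_sup (hU.map_blk_le a ⟨_, hw, rfl⟩) ⟨_, fun i => ?_, rfl⟩
      rw [blk_mulVec]
      exact Submodule.mem_sup_right (Submodule.subset_span ⟨w, hw, b i, rfl⟩)
  intro y hy
  have hsum : y = ∑ j, ι j fun c => y ⟨j, c⟩ := by
    ext ⟨j, c⟩
    rw [Finset.sum_apply, Finset.sum_eq_single j]
    · exact ((congrFun (hι j _ j) c).trans (by rw [Pi.single_eq_same])).symm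
    · intro j' _ hj
      exact (congrFun (hι j' _ j) c).trans (by rw [Pi.single_eq_of_ne hj.symm]; rfl)
    · simp
  rw [hsum]
  exact Submodule.sum_mem _ fun j _ => hle j (hy j)

/-- A generating pair together with the numerical criterion yields a surjective block matrix. -/
theorem IsGeneratingPair.exists_surjective [Fintype J] {W : QRep Q β} {f f' : PathBlock xs ys}
    (hff' : IsGeneratingPair W f f')
    (hdim : ∀ U, SubRep W U →
      Module.finrank ℂ (blockSub U xs) ≤ Module.finrank ℂ (blockSub U ys))
    (hcard : ∑ i, β (xs i) = ∑ j, β (ys j)) :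
    ∃ g : PathBlock xs ys, Function.Surjective (blk W g).mulVecLin := by
  let S : Set (∀ x, Submodule ℂ (Fin (β x) → ℂ)) := {U | SubRep W U ∧
    ∃ g : PathBlock xs ys, blockSub U ys ≤ (blockSub U xs).map (blk W g).mulVecLin}
  have hbot : (fun _ => ⊥) ∈ S := by
    refine ⟨fun a => by rw [Submodule.map_bot], 0, fun y hy => ?_⟩
    have : y = 0 := by
      ext ⟨j, c⟩
      exact congrFun ((Submodule.mem_bot ℂ).1 (hy j)) c
    rw [this]
    exact Submodule.zero_mem _
  obtain ⟨U, ⟨hU, g, hg⟩, hmax⟩ :=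
    (measure fun U : ∀ x, Submodule ℂ (Fin (β x) → ℂ) =>
      ∑ x, (β x - Module.finrank ℂ (U x))).wf.has_min S ⟨_, hbot⟩
  have hpencil : ∀ (f : PathBlock xs ys) (t : ℂ),
      (blk W g).mulVecLin + t • (blk W f).mulVecLin = (blk W (g + t • f)).mulVecLin := by
    intro f t
    refine LinearMap.ext fun v => ?_
    simp only [LinearMap.add_apply, LinearMap.smul_apply, Matrix.mulVecLin_apply, map_add,
      map_smul]
  have hg' := le_antisymm (hU.map_blk_le g) hg
  set K := (blockSub U ys).comap (blk W f).mulVecLin with hK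
  have hKU : K ≤ blockSub U xs := by
    have hU' := hU.sup (subRep_genSub W K)
    have hle : U ≤ fun x => U x ⊔ genSub W K x := fun x => le_sup_left
    obtain ⟨t, ht⟩ := (finite_not_le_map_add_smul_of_filtration (blk W g).mulVecLin
      (blk W f').mulVecLin (blockSub_mono hle xs) hg' (hU.map_blk_le f') (hU'.map_blk_le g)
      (hU'.map_blk_le f') (hff'.blockSub_le hU)).exists_notMem
    rw [Set.mem_ofPred_eq, not_not, hpencil] at ht
    have hmem : (fun x => U x ⊔ genSub W K x) ∈ S := ⟨hU', _, ht⟩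
    have hrank : ∀ x, Module.finrank ℂ ↥(U x ⊔ genSub W K x) ≤ β x := fun x =>
      (Submodule.finrank_le _).trans_eq (Module.finrank_fin_fun ℂ)
    have hmono : ∀ x, Module.finrank ℂ (U x) ≤ Module.finrank ℂ ↥(U x ⊔ genSub W K x) :=
      fun x => Submodule.finrank_mono (hle x)
    refine (le_blockSub_genSub W K).trans (blockSub_mono (fun x => ?_) xs)
    refine le_sup_right.trans (Submodule.eq_of_le_of_finrank_le (hle x) ?_).ge
    by_contra! hlt
    refine hmax _ hmem (Finset.sum_lt_sum (fun y _ => Nat.sub_le_sub_left (hmono y) _)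
      ⟨x, Finset.mem_univ x, ?_⟩)
    exact Nat.sub_lt_sub_left (hlt.trans_le (hrank x)) hlt
  have htop : ⊤ ≤ blockSub U ys ⊔ (⊤ : Submodule ℂ _).map (blk W f).mulVecLin := by
    have hker : LinearMap.ker ((blockSub U ys).mkQ ∘ₗ (blk W f).mulVecLin) = K := by
      rw [LinearMap.ker_comp, Submodule.ker_mkQ]
    have h1 := LinearMap.finrank_range_add_finrank_ker
      ((blockSub U ys).mkQ ∘ₗ (blk W f).mulVecLin)
    have h2 := Submodule.finrank_quotient_add_finrank (blockSub U ys)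
    have h3 := Submodule.finrank_mono hKU
    have h4 := hdim U hU
    rw [hker] at h1
    simp only [Module.finrank_fintype_fun_eq_card, Fintype.card_sigma, Fintype.card_fin] at h1 h2
    have hrange : LinearMap.range ((blockSub U ys).mkQ ∘ₗ (blk W f).mulVecLin) = ⊤ := by
      apply Submodule.eq_top_of_finrank_eq
      have := Submodule.finrank_le
        (LinearMap.range ((blockSub U ys).mkQ ∘ₗ (blk W f).mulVecLin))
      omega
    intro y _
    obtain ⟨x, hx⟩ := LinearMap.range_eq_top.1 hrange ((blockSub U ys).mkQ y)
    have hmem : y - (blk W f).mulVecLin x ∈ blockSub U ys := by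
      rw [← (blockSub U ys).ker_mkQ, LinearMap.mem_ker, map_sub, ← hx, sub_eq_zero]
      rfl
    have := Submodule.add_mem_sup hmem
      (Submodule.mem_map_of_mem (f := (blk W f).mulVecLin) (Submodule.mem_top (x := x)))
    rwa [sub_add_cancel] at this
  obtain ⟨t, ht⟩ := (finite_not_le_map_add_smul_of_filtration (blk W g).mulVecLin
    (blk W f).mulVecLin (le_top : blockSub U xs ≤ ⊤) hg' (hU.map_blk_le f) le_top le_top
    htop).exists_notMem
  rw [Set.mem_ofPred_eq, not_not, hpencil] at ht
  refine ⟨g + t • f, fun y => ?_⟩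
  obtain ⟨x, -, hx⟩ := ht (Submodule.mem_top (x := y))
  exact ⟨x, hx⟩

end Surjectivity

section DeterminantalSemiInvariants

variable {β : Q.V → ℕ}

/-- The algebra of polynomial functions on the space of representations. -/
def polyFun (β : Q.V → ℕ) : Subalgebra ℂ (QRep Q β → ℂ) :=
  (AlgHom.pi fun W : QRep Q β => MvPolynomial.aeval (R := ℂ) (repCoords W)).range

lemma isPolyFun_iff {F : QRep Q β → ℂ} : IsPolyFun F ↔ F ∈ polyFun β := by
  constructor
  · rintro ⟨P, hP⟩
    exact ⟨P, funext fun W => (hP W).symm⟩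
  · rintro ⟨P, rfl⟩
    exact ⟨P, fun W => rfl⟩

lemma entry_mem_polyFun (a : Q.A) (r : Fin (β (Q.h a))) (c : Fin (β (Q.t a))) :
    (fun W : QRep Q β => W a r c) ∈ polyFun β := by
  let q : RepCoord (Q := Q) β := ⟨a, r, c⟩
  exact isPolyFun_iff.1
    ⟨MvPolynomial.X q, fun W => (MvPolynomial.eval_X (f := repCoords W) q).symm⟩

lemma evalPath_mem_polyFun {x y : Q.V} (p : Quiver.Path x y) (r : Fin (β y)) (c : Fin (β x)) :
    (fun W : QRep Q β => evalPath W p r c) ∈ polyFun β := by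
  induction p with
  | nil =>
    simp only [evalPath]
    exact (polyFun β).algebraMap_mem ((1 : Matrix (Fin (β x)) (Fin (β x)) ℂ) r c)
  | cons p e ih =>
    obtain ⟨a, rfl, rfl⟩ := e
    have : (fun W : QRep Q β => evalPath W (p.cons (⟨a, rfl, rfl⟩ : Q.t a ⟶ Q.h a)) r c) =
        ∑ k, (fun W : QRep Q β => W a r k) * fun W => evalPath W p k c := by
      ext W
      rw [evalPath_cons_mk, Matrix.mul_apply, Finset.sum_apply]
      rfl
    rw [this]
    exact sum_mem fun k _ => mul_mem (entry_mem_polyFun a r k) (ih k)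

lemma evalLin_mem_polyFun {x y : Q.V} (h : PathComb x y) (r : Fin (β y)) (c : Fin (β x)) :
    (fun W : QRep Q β => evalLin W h r c) ∈ polyFun β := by
  have : (fun W : QRep Q β => evalLin W h r c) =
      ∑ p ∈ h.support, h p • fun W : QRep Q β => evalPath W p r c := by
    ext W
    rw [evalLin, Finsupp.sum, Matrix.sum_apply, Finset.sum_apply]
    rfl
  rw [this]
  exact sum_mem fun p _ => (polyFun β).smul_mem (evalPath_mem_polyFun p r c) _

lemma det_mem_polyFun {n : Type} [Fintype n] [DecidableEq n] {M : QRep Q β → Matrix n n ℂ}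
    (hM : ∀ i j, (fun W => M W i j) ∈ polyFun β) : (fun W => (M W).det) ∈ polyFun β := by
  have : (fun W => (M W).det) =
      ∑ s : Equiv.Perm n, ((Equiv.Perm.sign s : ℤ) : ℂ) • ∏ i, fun W => M W (s i) i := by
    ext W
    rw [Matrix.det_apply', Finset.sum_apply]
    simp only [Pi.smul_apply, Finset.prod_apply, smul_eq_mul]
  rw [this]
  exact sum_mem fun s _ => (polyFun β).smul_mem (prod_mem fun i _ => hM _ _) _

lemma evalPath_gAct (g : GLb β) (W : QRep Q β) {x y : Q.V} (p : Quiver.Path x y) :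
    evalPath (gAct g W) p * (g x).val = (g y).val * evalPath W p := by
  induction p with
  | nil => simp [evalPath]
  | cons p e ih =>
    obtain ⟨a, rfl, rfl⟩ := e
    rw [evalPath_cons_mk, evalPath_cons_mk, Matrix.mul_assoc, ih, gAct]
    simp only [Matrix.mul_assoc]
    rw [← Matrix.mul_assoc ((g (Q.t a))⁻¹).val, ← Units.val_mul, inv_mul_cancel, Units.val_one,
      Matrix.one_mul]

lemma evalLin_gAct (g : GLb β) (W : QRep Q β) {x y : Q.V} (h : PathComb x y) :
    evalLin (gAct g W) h * (g x).val = (g y).val * evalLin W h := by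
  simp only [evalLin, Finsupp.sum, Matrix.sum_mul, Matrix.mul_sum, Matrix.smul_mul,
    Matrix.mul_smul, evalPath_gAct]

variable {I J : Type} [Fintype I] [Fintype J] [DecidableEq I] [DecidableEq J]
  {xs : I → Q.V} {ys : J → Q.V}

lemma blk_gAct (g : GLb β) (W : QRep Q β) (h : PathBlock xs ys) :
    blk (gAct g W) h * blockDiagonal' (fun i => (g (xs i)).val) =
      blockDiagonal' (fun j => (g (ys j)).val) * blk W h := by
  ext ⟨j, r⟩ ⟨i, c⟩
  have := congrFun (congrFun (evalLin_gAct g W (h j i)) r) c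
  simp only [Matrix.mul_apply] at this
  simp only [Matrix.mul_apply, Fintype.sum_sigma]
  rw [Finset.sum_eq_single i, Finset.sum_eq_single j]
  · simpa only [blockDiagonal'_apply_eq, blk_apply] using this
  · intro j' _ hj
    exact Finset.sum_eq_zero fun k _ => by rw [blockDiagonal'_apply_ne _ _ _ hj.symm, zero_mul]
  · simp
  · intro i' _ hi
    exact Finset.sum_eq_zero fun k _ => by rw [blockDiagonal'_apply_ne _ _ _ hi, mul_zero]
  · simp

lemma det_blockDiagonal' {m : I → Type} [∀ i, Fintype (m i)]
    [∀ i, DecidableEq (m i)] (M : ∀ i, Matrix (m i) (m i) ℂ) :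
    (blockDiagonal' M).det = ∏ i, (M i).det := by
  let _ : LinearOrder I := LinearOrder.lift' (Fintype.equivFin I) (Fintype.equivFin I).injective
  rw [BlockTriangular.det_fintype (b := Sigma.fst)]
  · refine Finset.prod_congr rfl fun i _ => ?_
    rw [← Matrix.det_submatrix_equiv_self (Equiv.sigmaSubtype i).symm]
    congr 1
    ext r c
    exact blockDiagonal'_apply_eq M i r c
  · rintro ⟨i, r⟩ ⟨j, c⟩ hij
    exact blockDiagonal'_apply_ne M r c hij.ne'

/-- The determinant of a square block matrix of path combinations is a semi-invariant. -/
lemma isSemiInvariant_det (h : PathBlock xs ys)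
    (e : (Σ j, Fin (β (ys j))) ≃ Σ i, Fin (β (xs i))) {σ : Q.V → ℤ}
    (hσ : ∀ g : GLb β, chi σ g * ∏ i, (g (xs i)).val.det = ∏ j, (g (ys j)).val.det) :
    IsSemiInvariant σ fun W : QRep Q β => ((blk W h).submatrix id e).det := by
  refine ⟨isPolyFun_iff.2 (det_mem_polyFun fun q q' => evalLin_mem_polyFun _ _ _),
    fun g W => ?_⟩
  have hne : ∏ i, (g (xs i)).val.det ≠ 0 := Finset.prod_ne_zero_iff.2 fun i _ =>
    ((g (xs i)).isUnit.map Matrix.detMonoidHom).ne_zero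
  have := congrArg (fun M => (M.submatrix id e).det) (blk_gAct g W h)
  rw [Matrix.submatrix_mul _ _ id e e e.bijective, Matrix.det_mul,
    Matrix.det_submatrix_equiv_self, Matrix.submatrix_mul _ _ id id e Function.bijective_id,
    Matrix.det_mul, Matrix.submatrix_id_id, det_blockDiagonal', det_blockDiagonal', ← hσ] at this
  apply mul_right_cancel₀ hne
  rw [this]
  ring

lemma det_ne_zero_of_surjective {m n : Type} [Fintype m] [Fintype n] [DecidableEq m]
    (e : m ≃ n) {M : Matrix m n ℂ} (hM : Function.Surjective M.mulVecLin) :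
    (M.submatrix id e).det ≠ 0 := by
  have hsurj : Function.Surjective (M.submatrix id e).mulVec := by
    intro y
    obtain ⟨v, hv⟩ := hM y
    refine ⟨v ∘ e, ?_⟩
    rw [Matrix.submatrix_mulVec_equiv]
    simpa [Function.comp_assoc] using hv
  exact ((Matrix.isUnit_iff_isUnit_det _).1 (Matrix.mulVec_surjective_iff_isUnit.1 hsurj)).ne_zero

end DeterminantalSemiInvariants

section Saturation

variable {β : Q.V → ℕ}

lemma chi_mul_prod_toNat_neg (σ : Q.V → ℤ) (g : GLb β) :
    chi σ g * ∏ i : Σ x, Fin (-σ x).toNat, (g i.1).val.det =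
      ∏ j : Σ x, Fin (σ x).toNat, (g j.1).val.det := by
  rw [chi, Fintype.prod_sigma, Fintype.prod_sigma, ← Finset.prod_mul_distrib]
  refine Finset.prod_congr rfl fun x _ => ?_
  change _ * ∏ _i : Fin (-σ x).toNat, (g x).val.det = ∏ _j : Fin (σ x).toNat, (g x).val.det
  rw [Finset.prod_const, Finset.prod_const, Finset.card_univ, Finset.card_univ, Fintype.card_fin,
    Fintype.card_fin]
  have hne : (g x).val.det ≠ 0 := ((g x).isUnit.map Matrix.detMonoidHom).ne_zero
  rw [← zpow_natCast, ← zpow_natCast, ← zpow_add₀ hne]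
  congr 1
  omega

lemma sum_toNat_sub_sum_toNat_neg (σ : Q.V → ℤ) (d : Q.V → ℕ) :
    ((∑ j : Σ x, Fin (σ x).toNat, d j.1 : ℕ) : ℤ) - (∑ i : Σ x, Fin (-σ x).toNat, d i.1 : ℕ) =
      ∑ x, σ x * (d x : ℤ) := by
  simp only [Fintype.sum_sigma, Finset.sum_const, Finset.card_univ, Fintype.card_fin,
    smul_eq_mul, Nat.cast_sum, Nat.cast_mul, ← Finset.sum_sub_distrib, ← sub_mul]
  refine Finset.sum_congr rfl fun x _ => ?_
  congr 1
  omega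

/-- Over a tame algebra, every weight is saturated. -/
theorem wSaturated_of_isTame [Finite Q.A] (W : QRep Q β) (htame : IsTame (annRel W))
    (σ : Q.V → ℤ) : WSaturated W σ := by
  classical
  rintro ⟨n, hn, F, hF, hFW⟩
  have hn' : (0 : ℤ) < n := by exact_mod_cast hn
  have hdim : ∀ U, SubRep W U → 0 ≤ ∑ x, σ x * (Module.finrank ℂ (U x) : ℤ) := by
    intro U hU
    have := hF.sum_finrank_nonneg hFW hU
    simp only [mul_assoc, ← Finset.mul_sum] at this
    exact nonneg_of_mul_nonneg_right this hn'
  have hzero : ∑ x, σ x * (β x : ℤ) = 0 := by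
    have := hF.sum_eq_zero hFW
    simp only [mul_assoc, ← Finset.mul_sum] at this
    exact (mul_eq_zero.1 this).resolve_left hn'.ne'
  let xs : (Σ x, Fin (-σ x).toNat) → Q.V := Sigma.fst
  let ys : (Σ x, Fin (σ x).toNat) → Q.V := Sigma.fst
  have hcard : ∑ i, β (xs i) = ∑ j, β (ys j) := by
    have := sum_toNat_sub_sum_toNat_neg σ β
    rw [hzero, sub_eq_zero] at this
    exact_mod_cast this.symm
  obtain ⟨f, f', hff'⟩ := exists_generating_pair W htame xs ys
  obtain ⟨g, hg⟩ := IsGeneratingPair.exists_surjective hff' (fun U hU => by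
    have := sum_toNat_sub_sum_toNat_neg σ fun x => Module.finrank ℂ (U x)
    have h := hdim U hU
    rw [← this, sub_nonneg] at h
    rw [finrank_blockSub, finrank_blockSub]
    exact_mod_cast h) hcard
  let e : (Σ j, Fin (β (ys j))) ≃ Σ i, Fin (β (xs i)) :=
    Fintype.equivOfCardEq (by simp only [Fintype.card_sigma, Fintype.card_fin, hcard])
  exact ⟨_, isSemiInvariant_det g e (chi_mul_prod_toNat_neg σ), det_ne_zero_of_surjective e hg⟩

end Saturation

/-- Let `(Q,R)` be a connected acyclic bound quiver with bound quiver
algebra `A = ℂQ/⟨R⟩`, `β` a dimension vector, and `W ∈ mod(A,β)` such that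
`B = A/Ann_A(W) ≅ ℂQ/Ann_{ℂQ}(W)` is a tame algebra.  Then every weight `σ` in the weight
semigroup `L_W` is `W`-saturated: if `nσ ∈ S_Q(W)` for some integer `n ≥ 1`, then
`σ ∈ S_Q(W)`. -/
theorem statement2 (Q : Quiv) [Fintype Q.A] (hconn : QConnected Q) (hacyc : QAcyclic Q)
    (R : Set (FormalRel Q)) (hRfin : R.Finite) (hRadm : AdmissibleRels R)
    (β : Q.V → ℕ) (W : QRep Q β) (hW : W ∈ modSet R β)
    (htame : IsTame (annRel W))
    (σ : Q.V → ℤ) (hσ : σ ∈ weightSgrp W) :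
    WSaturated W σ := by
  exact wSaturated_of_isTame W htame σ
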